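/- Every reduced Gröbner basis G of the ideal ⟨𝓕⟩ ⊆ Z2[X] with respect to the lexicographic order ≼_lex satisfies |G| ≥ 2^(2^n) and moreover |{p ∈ G : deg(p) ≥ 2^(2^n)}| ≥ 2^(2^n), where deg(p) denotes the maximal total degree of a monomial occurring in p. -/

import Mathlib

open MvPolynomial

/-- Monomials in the variables `σ`, represented by their exponent vectors. -/
abbrev Mon (σ : Type*) := σ →₀ ℕ

/-- A monomial order: a total order on monomials such that `1 ≼ t` for every monomial `t`
and `t ≼ u → t·v ≼ u·v` (written additively on exponent vectors). -/
structure MonOrd (σ : Type*) where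
  le : Mon σ → Mon σ → Prop
  le_refl : ∀ t, le t t
  le_trans : ∀ t u v, le t u → le u v → le t v
  le_antisymm : ∀ t u, le t u → le u t → t = u
  le_total : ∀ t u, le t u ∨ le u t
  zero_le : ∀ t, le 0 t
  add_le_add : ∀ t u v, le t u → le (t + v) (u + v)

/-- Strict version of a monomial order. -/
def MonOrd.lt {σ : Type*} (μ : MonOrd σ) (t u : Mon σ) : Prop := μ.le t u ∧ t ≠ u

/-- The extension of a monomial order (given by the relation `r` on monomials) to polynomials:
`g ≼ f` iff `g = f` or the greatest monomial on which `f` and `g` differ occurs in `f`.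
(This is the closed form of the recursive definition: `g ≼ f` iff `g = f`, or
`HT g ≺ HT f`, or `HT g = HT f` and `g - HT g ≼ f - HT f`, with `0` the least polynomial.) -/
def polyLe {σ : Type*} (r : Mon σ → Mon σ → Prop) (g f : MvPolynomial σ (ZMod 2)) : Prop :=
  g = f ∨ ∃ t, t ∈ f.support ∧ t ∉ g.support ∧
    ∀ u : Mon σ, ((u ∈ f.support ∧ u ∉ g.support) ∨ (u ∈ g.support ∧ u ∉ f.support)) → r u t

/-- Strict extension of a monomial order to polynomials. -/
def polyLt {σ : Type*} (r : Mon σ → Mon σ → Prop) (g f : MvPolynomial σ (ZMod 2)) : Prop :=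
  polyLe r g f ∧ g ≠ f

/-- `S_F`: the set of non-residual polynomials with respect to `F` and the monomial order `r`,
i.e. those `f` admitting a `g` with `f + g ∈ ⟨F⟩` and `g ≺ f`. -/
def SF {σ : Type*} (r : Mon σ → Mon σ → Prop) (F : Set (MvPolynomial σ (ZMod 2))) :
    Set (MvPolynomial σ (ZMod 2)) :=
  {f | ∃ g, f + g ∈ Ideal.span F ∧ polyLt r g f}

/-- `t` is the head monomial (`r`-greatest monomial) of the polynomial `f`. -/
def IsHT {σ : Type*} (r : Mon σ → Mon σ → Prop) (f : MvPolynomial σ (ZMod 2)) (t : Mon σ) :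
    Prop :=
  t ∈ f.support ∧ ∀ u ∈ f.support, r u t

/-- `HT(S)`: the set of head monomials (as polynomials) of the nonzero elements of `S`. -/
def HTset {σ : Type*} (r : Mon σ → Mon σ → Prop) (S : Set (MvPolynomial σ (ZMod 2))) :
    Set (MvPolynomial σ (ZMod 2)) :=
  {p | ∃ f ∈ S, f ≠ 0 ∧ ∃ t, IsHT r f t ∧ p = monomial t 1}

/-- The divisibility (componentwise) order `◁` on monomials. -/
def triMon {σ : Type*} (t u : Mon σ) : Prop := ∀ x, t x ≤ u x

/-- The order `◁` on polynomials: `p ◁ q` iff there is an injective map `φ` from the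
monomials of `p` to the monomials of `q` with `t ◁ φ t` for each monomial `t` of `p`. -/
def triPoly {σ : Type*} (p q : MvPolynomial σ (ZMod 2)) : Prop :=
  ∃ φ : Mon σ → Mon σ, Set.InjOn φ ↑p.support ∧ ∀ t ∈ p.support, φ t ∈ q.support ∧ triMon t (φ t)

/-- Upward closure with respect to `◁`. -/
def upClo {σ : Type*} (A : Set (MvPolynomial σ (ZMod 2))) : Set (MvPolynomial σ (ZMod 2)) :=
  {q | ∃ p ∈ A, triPoly p q}

/-- `Min_◁(A)`: the `◁`-minimal elements of `A`. -/
def minTri {σ : Type*} (A : Set (MvPolynomial σ (ZMod 2))) : Set (MvPolynomial σ (ZMod 2)) :=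
  {p | p ∈ A ∧ ∀ q ∈ A, triPoly q p → q = p}

/-- `G` is a Gröbner basis of the ideal `I` with respect to the monomial order `r`. -/
def IsGB {σ : Type*} (r : Mon σ → Mon σ → Prop) (G : Finset (MvPolynomial σ (ZMod 2)))
    (I : Ideal (MvPolynomial σ (ZMod 2))) : Prop :=
  (↑G : Set (MvPolynomial σ (ZMod 2))) ⊆ ↑I ∧
    Ideal.span (↑G : Set (MvPolynomial σ (ZMod 2))) = I ∧
    Ideal.span (HTset r (↑I : Set (MvPolynomial σ (ZMod 2)))) = Ideal.span (HTset r ↑G)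

/-- `G` is a reduced Gröbner basis of `I` with respect to `r`. -/
def IsReducedGB {σ : Type*} (r : Mon σ → Mon σ → Prop) (G : Finset (MvPolynomial σ (ZMod 2)))
    (I : Ideal (MvPolynomial σ (ZMod 2))) : Prop :=
  IsGB r G I ∧ ∀ f ∈ G, ¬ ∀ t ∈ f.support,
    (monomial t 1 : MvPolynomial σ (ZMod 2)) ∈
      Ideal.span (HTset r ((↑G : Set (MvPolynomial σ (ZMod 2))) \ {f}))

/-- The variable set `X`: the special variables `s, ℓ, c, c̄, b, b̄` together with, for each
`0 ≤ i ≤ n`, the variables `s_i, f_i, q_{ji}, c_{ji}, b_{ji}` (`1 ≤ j ≤ 4`, encoded by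
`j : Fin 4`) and their barred copies (`bar = true`). -/
inductive MVar (n : ℕ) : Type where
  | vs | vl | vc | vcb | vb | vbb
  | vS (bar : Bool) (i : Fin (n+1))
  | vF (bar : Bool) (i : Fin (n+1))
  | vQ (bar : Bool) (j : Fin 4) (i : Fin (n+1))
  | vC (bar : Bool) (j : Fin 4) (i : Fin (n+1))
  | vB (bar : Bool) (j : Fin 4) (i : Fin (n+1))
deriving DecidableEq

open MVar

abbrev MPoly (n : ℕ) := MvPolynomial (MVar n) (ZMod 2)

/-- `e(n) = 2^(2^n)`. -/
def en (n : ℕ) : ℕ := 2 ^ 2 ^ n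

/-- The set `P_0` (barred copy if `bar = true`). -/
def P0 (n : ℕ) (bar : Bool) : Set (MPoly n) :=
  {p | ∃ j : Fin 4, p =
    X (vB bar j 0) ^ 2 * X (vC bar j 0) * X (vF bar 0) + X (vC bar j 0) * X (vS bar 0)}

/-- The set `P_m` for `m = i+1`, `i : Fin n` (barred copy if `bar = true`).
Here `i.succ` plays the role of `m` and `i.castSucc` the role of `m-1`; the indices
`1,2,3,4` of the paper are encoded as `0,1,2,3 : Fin 4`. -/
def Pm (n : ℕ) (bar : Bool) (i : Fin n) : Set (MPoly n) :=
  ({ X (vQ bar 0 i.succ) * X (vC bar 0 i.castSucc) * X (vS bar i.castSucc) + X (vS bar i.succ),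
    X (vQ bar 1 i.succ) * X (vC bar 1 i.castSucc) * X (vS bar i.castSucc)
      + X (vQ bar 0 i.succ) * X (vB bar 0 i.castSucc) * X (vC bar 0 i.castSucc)
        * X (vF bar i.castSucc),
    X (vQ bar 2 i.succ) * X (vC bar 2 i.castSucc) * X (vF bar i.castSucc)
      + X (vQ bar 1 i.succ) * X (vC bar 1 i.castSucc) * X (vF bar i.castSucc),
    X (vQ bar 2 i.succ) * X (vB bar 0 i.castSucc) * X (vC bar 2 i.castSucc)
        * X (vS bar i.castSucc)
      + X (vQ bar 1 i.succ) * X (vB bar 3 i.castSucc) * X (vC bar 1 i.castSucc)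
        * X (vS bar i.castSucc),
    X (vQ bar 3 i.succ) * X (vB bar 3 i.castSucc) * X (vC bar 3 i.castSucc)
        * X (vF bar i.castSucc)
      + X (vQ bar 2 i.succ) * X (vC bar 2 i.castSucc) * X (vS bar i.castSucc),
    X (vQ bar 3 i.succ) * X (vC bar 3 i.castSucc) * X (vS bar i.castSucc)
      + X (vF bar i.succ) } : Set (MPoly n))
  ∪ {p | ∃ j : Fin 4, p =
      X (vQ bar 1 i.succ) * X (vB bar 2 i.castSucc) * X (vB bar j i.succ) * X (vC bar j i.succ)
          * X (vF bar i.castSucc)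
        + X (vQ bar 1 i.succ) * X (vB bar 1 i.castSucc) * X (vC bar j i.succ)
          * X (vF bar i.castSucc)}

/-- The set `P = P_0 ∪ P_1 ∪ ⋯ ∪ P_n`; for `bar = true` this is the barred copy `P̄`
(the image of `P` under the substitution replacing each variable by its barred version). -/
def PP (n : ℕ) (bar : Bool) : Set (MPoly n) := P0 n bar ∪ ⋃ i : Fin n, Pm n bar i

/-- The set `G` of seven extra binomials. -/
def GG (n : ℕ) : Set (MPoly n) :=
  { X (vB false 3 (Fin.last n)) * X vl * X vb + X vl * X vc,
    X (vB false 3 (Fin.last n)) * X vl * X vbb + X vl * X vcb,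
    X (vC false 3 (Fin.last n)) * X (vF false (Fin.last n)) + X vl,
    X (vC true 3 (Fin.last n)) * X (vF true (Fin.last n))
      + X (vC false 3 (Fin.last n)) * X (vS false (Fin.last n)),
    X (vB true 3 (Fin.last n)) * X (vC false 3 (Fin.last n)) * X (vS false (Fin.last n))
      + X (vC false 3 (Fin.last n)) * X (vS false (Fin.last n)) * X vb,
    X (vB true 3 (Fin.last n)) * X (vC false 3 (Fin.last n)) * X (vS false (Fin.last n))
      + X (vC false 3 (Fin.last n)) * X (vS false (Fin.last n)) * X vbb,
    X (vC true 3 (Fin.last n)) * X (vS true (Fin.last n)) + X vs }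

/-- The set `𝓕 = P ∪ P̄ ∪ G`. -/
def FF (n : ℕ) : Set (MPoly n) := PP n false ∪ PP n true ∪ GG n

/-- The set `C = {ℓ c̄^{m1} c^{m2} : m1 + m2 = e(n)}` of monomials. -/
def Cmon (n : ℕ) : Set (Mon (MVar n)) :=
  {α | ∃ m1 m2 : ℕ, m1 + m2 = en n ∧
    α = Finsupp.single vl 1 + Finsupp.single vcb m1 + Finsupp.single vc m2}

/-- The set `D = {ℓ^j c̄^{m1} c^{m2} : j ∈ {0,1}, j + m1 + m2 ≤ e(n)}` of monomials. -/
def Dmon (n : ℕ) : Set (Mon (MVar n)) :=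
  {α | ∃ j m1 m2 : ℕ, j ≤ 1 ∧ j + m1 + m2 ≤ en n ∧
    α = Finsupp.single vl j + Finsupp.single vcb m1 + Finsupp.single vc m2}

/-- An injective rank function on the variables realizing the variable ordering
(from least to greatest): `s, c, c̄, ℓ, b, b̄`; then `s_0,…,s_n`; `f_0,…,f_n`;
`c_{10},…,c_{1n}; …; c_{40},…,c_{4n}`; `b_{10},…,b_{4n}`; `q_{10},…,q_{4n}`;
then the barred variables in the same pattern. -/
def vrank (n : ℕ) : MVar n → ℕ
  | .vs => 0
  | .vc => 1
  | .vcb => 2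
  | .vl => 3
  | .vb => 4
  | .vbb => 5
  | .vS bar i => 6 + (cond bar (14 * (n+1)) 0) + (i : ℕ)
  | .vF bar i => 6 + (cond bar (14 * (n+1)) 0) + (n+1) + (i : ℕ)
  | .vC bar j i => 6 + (cond bar (14 * (n+1)) 0) + 2*(n+1) + (j : ℕ)*(n+1) + (i : ℕ)
  | .vB bar j i => 6 + (cond bar (14 * (n+1)) 0) + 6*(n+1) + (j : ℕ)*(n+1) + (i : ℕ)
  | .vQ bar j i => 6 + (cond bar (14 * (n+1)) 0) + 10*(n+1) + (j : ℕ)*(n+1) + (i : ℕ)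

/-- The lexicographic monomial order on `X`: `t ≼_lex u` iff `t = u` or the exponents differ
somewhere and at the greatest variable (w.r.t. `vrank`) where they differ, the exponent of
`t` is smaller. -/
def lexLe (n : ℕ) (t u : Mon (MVar n)) : Prop :=
  t = u ∨ ∃ x : MVar n, t x < u x ∧ ∀ y : MVar n, vrank n x < vrank n y → t y = u y

/-- The total degree of a monomial. -/
def mdeg {σ : Type*} (t : Mon σ) : ℕ := t.sum fun _ k => k

/-- The degree lexicographic monomial order. -/
def degLexLe (n : ℕ) (t u : Mon (MVar n)) : Prop :=
  mdeg t < mdeg u ∨ (mdeg t = mdeg u ∧ lexLe n t u)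

/-- Weighted degree of a monomial with respect to a weight map `w`. -/
noncomputable def wdeg {n : ℕ} (w : MVar n → ℝ) (t : Mon (MVar n)) : ℝ :=
  t.sum fun x k => (k : ℝ) * w x

/-- The weighted monomial order determined by the weight map `w`. -/
def wLe {n : ℕ} (w : MVar n → ℝ) (t u : Mon (MVar n)) : Prop := t = u ∨ wdeg w t < wdeg w u


set_option linter.all false
set_option linter.unusedSimpArgs false
set_option linter.unnecessarySeqFocus false
set_option linter.unusedVariables false

/-! ### Combinatorial invariant of the counting machine -/

/-- An abstract configuration. -/
structure Conf where
  S : ℕ → ℕ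
  F : ℕ → ℕ
  C : Fin 4 → ℕ → ℕ
  B : Fin 4 → ℕ → ℕ

/-- Levels below `m` are empty. -/
def Zl (m : ℕ) (t : Conf) : Prop :=
  ∀ k < m, t.S k = 0 ∧ t.F k = 0 ∧ ∀ j, t.C j k = 0 ∧ t.B j k = 0

/-- The local invariant of one level. -/
def Lv (E : ℕ) (c b : Fin 4 → ℕ) (M N : ℕ) : Prop :=
  (c 0 = 0 ∧ c 1 = 0 ∧ c 2 = 0 ∧ c 3 = 1 ∧ b 1 = 0 ∧ b 2 = 0 ∧ b 0 + b 3 = M ∧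
    N + E * b 0 = E * E) ∨
  (c 0 = 0 ∧ c 1 = 0 ∧ c 2 = 1 ∧ c 3 = 0 ∧ b 1 + b 2 = M ∧ b 0 + b 3 + 1 = E ∧
    N + b 1 = E * b 3 + E) ∨
  (c 0 = 0 ∧ c 1 = 1 ∧ c 2 = 0 ∧ c 3 = 0 ∧ b 1 + b 2 = M ∧ b 0 + b 3 + 1 = E ∧
    N = E * b 3 + b 2) ∨
  (c 0 = 1 ∧ c 1 = 0 ∧ c 2 = 0 ∧ c 3 = 0 ∧ b 1 = 0 ∧ b 2 = 0 ∧ b 0 + b 3 = M ∧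
    N = E * b 3)

/-- The invariant up to level `m`, with remaining amount `N`. -/
def Rl : ℕ → Conf → ℕ → Prop
  | 0, t, N => (t.S 0 = 1 ∧ t.F 0 = 0 ∧ N = 0) ∨ (t.S 0 = 0 ∧ t.F 0 = 1 ∧ N = 2)
  | m+1, t, N => (t.S (m+1) = 1 ∧ t.F (m+1) = 0 ∧ Zl (m+1) t ∧ N = 0) ∨
      (t.S (m+1) = 0 ∧ t.F (m+1) = 1 ∧ Zl (m+1) t ∧ N = en (m+1)) ∨
      (t.S (m+1) = 0 ∧ t.F (m+1) = 0 ∧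
        ∃ M, Rl m t M ∧ Lv (en m) (fun j => t.C j m) (fun j => t.B j m) M N)

lemma en_succ (m : ℕ) : en (m+1) = en m * en m := by
  unfold en; rw [pow_succ 2 m, mul_two, pow_add]

lemma en_zero : en 0 = 2 := by simp [en]

lemma en_pos (m : ℕ) : 0 < en m := by unfold en; positivity

lemma Rl_S {m : ℕ} {t : Conf} (h : 1 ≤ t.S m) (N : ℕ) :
    Rl m t N ↔ t.S m = 1 ∧ t.F m = 0 ∧ Zl m t ∧ N = 0 := by
  cases m with
  | zero =>
    simp only [Rl, Zl]
    constructor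
    · rintro (h | h) <;> simp_all
    · rintro ⟨h1, h2, -, h3⟩; exact Or.inl ⟨h1, h2, h3⟩
  | succ m =>
    simp only [Rl]
    constructor
    · rintro (h | h | h)
      · exact h
      · omega
      · omega
    · intro h; exact Or.inl h

lemma Rl_F {m : ℕ} {t : Conf} (h : 1 ≤ t.F m) (N : ℕ) :
    Rl m t N ↔ t.S m = 0 ∧ t.F m = 1 ∧ Zl m t ∧ N = en m := by
  cases m with
  | zero =>
    simp only [Rl, Zl, en_zero]
    constructor
    · rintro (h | h) <;> simp_all
    · rintro ⟨h1, h2, -, h3⟩; exact Or.inr ⟨h1, h2, h3⟩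
  | succ m =>
    simp only [Rl]
    constructor
    · rintro (h | h | h)
      · omega
      · exact h
      · omega
    · intro h; exact Or.inr (Or.inl h)

lemma not_Zl {m k : ℕ} {t : Conf} (hk : k < m) (h : 1 ≤ t.S k ∨ 1 ≤ t.F k) : ¬ Zl m t := by
  intro hz
  obtain ⟨h1, h2, -⟩ := hz k hk
  omega

lemma Rl_succ {m k : ℕ} {t : Conf} (hk : k ≤ m) (h : 1 ≤ t.S k ∨ 1 ≤ t.F k) (N : ℕ) :
    Rl (m+1) t N ↔ (t.S (m+1) = 0 ∧ t.F (m+1) = 0 ∧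
        ∃ M, Rl m t M ∧ Lv (en m) (fun j => t.C j m) (fun j => t.B j m) M N) := by
  have := not_Zl (Nat.lt_succ_of_le hk) h
  simp only [Rl, this, false_and, and_false, false_or]

lemma Rl_succ_S {m : ℕ} {t : Conf} (h : 1 ≤ t.S m) (N : ℕ) :
    Rl (m+1) t N ↔ (t.S (m+1) = 0 ∧ t.F (m+1) = 0 ∧ t.S m = 1 ∧ t.F m = 0 ∧ Zl m t ∧
        Lv (en m) (fun j => t.C j m) (fun j => t.B j m) 0 N) := by
  rw [Rl_succ le_rfl (Or.inl h)]
  simp only [Rl_S h]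
  constructor
  · rintro ⟨h1, h2, M, ⟨h3, h4, h5, rfl⟩, h6⟩; exact ⟨h1, h2, h3, h4, h5, h6⟩
  · rintro ⟨h1, h2, h3, h4, h5, h6⟩; exact ⟨h1, h2, 0, ⟨h3, h4, h5, rfl⟩, h6⟩

lemma Rl_succ_F {m : ℕ} {t : Conf} (h : 1 ≤ t.F m) (N : ℕ) :
    Rl (m+1) t N ↔ (t.S (m+1) = 0 ∧ t.F (m+1) = 0 ∧ t.S m = 0 ∧ t.F m = 1 ∧ Zl m t ∧
        Lv (en m) (fun j => t.C j m) (fun j => t.B j m) (en m) N) := by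
  rw [Rl_succ le_rfl (Or.inr h)]
  simp only [Rl_F h]
  constructor
  · rintro ⟨h1, h2, M, ⟨h3, h4, h5, rfl⟩, h6⟩; exact ⟨h1, h2, h3, h4, h5, h6⟩
  · rintro ⟨h1, h2, h3, h4, h5, h6⟩; exact ⟨h1, h2, _, ⟨h3, h4, h5, rfl⟩, h6⟩

/-- Propagation of equivalence to higher levels. -/
lemma Rl_prop {m : ℕ} {t t' : Conf} (ht : ∃ k ≤ m, 1 ≤ t.S k ∨ 1 ≤ t.F k)
    (ht' : ∃ k ≤ m, 1 ≤ t'.S k ∨ 1 ≤ t'.F k)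
    (hSF : ∀ i, m < i → t.S i = t'.S i ∧ t.F i = t'.F i)
    (hCB : ∀ i, m ≤ i → ∀ j, t.C j i = t'.C j i ∧ t.B j i = t'.B j i)
    (h : ∀ N, Rl m t N ↔ Rl m t' N) (k : ℕ) (hk : m ≤ k) (N : ℕ) : Rl k t N ↔ Rl k t' N := by
  induction k, hk using Nat.le_induction generalizing N with
  | base => exact h N
  | succ k hk ih =>
    obtain ⟨i, hi, hti⟩ := ht
    obtain ⟨i', hi', hti'⟩ := ht'
    rw [Rl_succ (hi.trans hk) hti, Rl_succ (hi'.trans hk) hti', (hSF (k+1) (by omega)).1,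
      (hSF (k+1) (by omega)).2]
    simp only [(hCB k hk _).1, (hCB k hk _).2, ih]

/-- Shifting the inner amount together with the counter of the active state. -/
lemma Lv_shift {E : ℕ} {c b b' : Fin 4 → ℕ} (i : Fin 4) (k : ℕ) (hc : 1 ≤ c i)
    (hb : b i = b' i + k) (hb' : ∀ j, j ≠ i → b j = b' j) (M N : ℕ) :
    Lv E c b (M + k) N ↔ Lv E c b' M N := by
  have h0 := hb' 0
  have h1 := hb' 1
  have h2 := hb' 2
  have h3 := hb' 3
  unfold Lv
  fin_cases i <;> simp at hb hc h0 h1 h2 h3 <;> simp only [hb, h0, h1, h2, h3] <;>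
    refine or_congr ?_ (or_congr ?_ (or_congr ?_ ?_)) <;> omega

/-- Level-`m` shift relation. -/
def Rsh (m k : ℕ) (t t' : Conf) : Prop :=
  ∀ N, Rl m t N ↔ ∃ M, N = M + k ∧ Rl m t' M

lemma Rl_shift {m k : ℕ} {t t' : Conf} (ht : ∃ k ≤ m, 1 ≤ t.S k ∨ 1 ≤ t.F k)
    (ht' : ∃ k ≤ m, 1 ≤ t'.S k ∨ 1 ≤ t'.F k)
    (hSF : t.S (m+1) = t'.S (m+1) ∧ t.F (m+1) = t'.F (m+1)) (i : Fin 4)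
    (hC : ∀ j, t.C j m = t'.C j m) (hCi : 1 ≤ t.C i m)
    (hBi : t.B i m = t'.B i m + k) (hB : ∀ j, j ≠ i → t.B j m = t'.B j m)
    (h : Rsh m k t t') (N : ℕ) : Rl (m+1) t N ↔ Rl (m+1) t' N := by
  obtain ⟨l, hl, htl⟩ := ht
  obtain ⟨l', hl', htl'⟩ := ht'
  rw [Rl_succ hl htl, Rl_succ hl' htl', hSF.1, hSF.2]
  have key := fun M N => Lv_shift (E := en m) (c := fun j => t.C j m) (b := fun j => t.B j m)
    (b' := fun j => t'.B j m) i k hCi hBi hB M N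
  have hc : (fun j => t.C j m) = fun j => t'.C j m := funext hC
  constructor
  · rintro ⟨h1, h2, M, hM, hL⟩
    obtain ⟨M', rfl, hM'⟩ := (h M).1 hM
    exact ⟨h1, h2, M', hM', hc ▸ (key _ _).1 hL⟩
  · rintro ⟨h1, h2, M, hM, hL⟩
    refine ⟨h1, h2, M + k, (h _).2 ⟨M, rfl, hM⟩, (key _ _).2 (hc ▸ hL)⟩

/-- The configuration (unbarred part) of a monomial. -/
def conf (n : ℕ) (t : Mon (MVar n)) : Conf where
  S m := if h : m < n + 1 then t (vS false ⟨m, h⟩) else 0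
  F m := if h : m < n + 1 then t (vF false ⟨m, h⟩) else 0
  C j m := if h : m < n + 1 then t (vC false j ⟨m, h⟩) else 0
  B j m := if h : m < n + 1 then t (vB false j ⟨m, h⟩) else 0

/-- The congruence-closed set of monomials containing `ℓ c^a c̄^b`. -/
def Sab (n a b : ℕ) (t : Mon (MVar n)) : Prop :=
  t vs = 0 ∧ (∀ i, t (vS true i) = 0 ∧ t (vF true i) = 0) ∧
  t vc + t vb = a ∧ t vcb + t vbb = b ∧
  ((t vl = 1 ∧ Zl n (conf n t) ∧ (conf n t).S n = 0 ∧ (conf n t).F n = 0 ∧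
      (∀ j, (conf n t).C j n = 0) ∧ (conf n t).B 0 n = 0 ∧ (conf n t).B 1 n = 0 ∧
      (conf n t).B 2 n = 0 ∧ (conf n t).B 3 n = t vb + t vbb) ∨
   (t vl = 0 ∧ ∃ N, Rl n (conf n t) N ∧
      (conf n t).C 0 n = 0 ∧ (conf n t).C 1 n = 0 ∧ (conf n t).C 2 n = 0 ∧ (conf n t).C 3 n = 1 ∧
      (conf n t).B 0 n = 0 ∧ (conf n t).B 1 n = 0 ∧ (conf n t).B 2 n = 0 ∧
      (conf n t).B 3 n + en n = N + t vb + t vbb))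

/-- Two monomials agree outside the unbarred machine variables. -/
def SpecEq {n : ℕ} (t t' : Mon (MVar n)) : Prop :=
  t vs = t' vs ∧ (∀ i, t (vS true i) = t' (vS true i) ∧ t (vF true i) = t' (vF true i)) ∧
  t vc = t' vc ∧ t vb = t' vb ∧ t vcb = t' vcb ∧ t vbb = t' vbb ∧ t vl = t' vl

/-- There is a token in the configuration. -/
def Tok (m : ℕ) (t : Conf) : Prop := ∃ k ≤ m, 1 ≤ t.S k ∨ 1 ≤ t.F k

lemma Tok.not {m : ℕ} {t : Conf} (h : Tok m t) : ¬ (Zl m t ∧ t.S m = 0 ∧ t.F m = 0) := by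
  rintro ⟨hz, h1, h2⟩
  obtain ⟨k, hk, h⟩ := h
  rcases hk.lt_or_eq with hk | rfl
  · exact not_Zl hk h hz
  · omega

lemma Tok.mono {m k : ℕ} {t : Conf} (h : Tok m t) (hk : m ≤ k) : Tok k t := by
  obtain ⟨i, hi, h⟩ := h
  exact ⟨i, hi.trans hk, h⟩

lemma Sab_tok {n a b : ℕ} {t : Mon (MVar n)} (h : Tok n (conf n t)) :
    Sab n a b t ↔ (t vs = 0 ∧ (∀ i, t (vS true i) = 0 ∧ t (vF true i) = 0) ∧
  t vc + t vb = a ∧ t vcb + t vbb = b ∧ t vl = 0 ∧ ∃ N, Rl n (conf n t) N ∧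
      (conf n t).C 0 n = 0 ∧ (conf n t).C 1 n = 0 ∧ (conf n t).C 2 n = 0 ∧ (conf n t).C 3 n = 1 ∧
      (conf n t).B 0 n = 0 ∧ (conf n t).B 1 n = 0 ∧ (conf n t).B 2 n = 0 ∧
      (conf n t).B 3 n + en n = N + t vb + t vbb) := by
  have := h.not
  unfold Sab
  refine and_congr_right fun _ => and_congr_right fun _ => and_congr_right fun _ =>
      and_congr_right fun _ => ?_
  constructor
  · rintro (⟨-, h1, h2, h3, -⟩ | h)
    · exact absurd ⟨h1, h2, h3⟩ this
    · exact h
  · exact Or.inr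

lemma topA {n a b : ℕ} {t t' : Mon (MVar n)} (hs : SpecEq t t') (ht : Tok n (conf n t))
    (ht' : Tok n (conf n t'))
    (hCB : ∀ j, (conf n t).C j n = (conf n t').C j n ∧ (conf n t).B j n = (conf n t').B j n)
    (h : ∀ N, Rl n (conf n t) N ↔ Rl n (conf n t') N) : Sab n a b t ↔ Sab n a b t' := by
  obtain ⟨h1, h2, h3, h4, h5, h6, h7⟩ := hs
  rw [Sab_tok ht, Sab_tok ht']
  simp only [h1, h2, h3, h4, h5, h6, h7, hCB, h]

lemma topA' {n a b m : ℕ} (hm : m ≤ n) {t t' : Mon (MVar n)} (hs : SpecEq t t')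
    (ht : Tok m (conf n t)) (ht' : Tok m (conf n t'))
    (hSF : ∀ i, m < i → (conf n t).S i = (conf n t').S i ∧ (conf n t).F i = (conf n t').F i)
    (hCB : ∀ i, m ≤ i → ∀ j, (conf n t).C j i = (conf n t').C j i ∧
      (conf n t).B j i = (conf n t').B j i)
    (h : ∀ N, Rl m (conf n t) N ↔ Rl m (conf n t') N) : Sab n a b t ↔ Sab n a b t' :=
  topA hs (ht.mono hm) (ht'.mono hm) (hCB n hm) (Rl_prop ht ht' hSF hCB h n hm)

lemma topB {n a b m : ℕ} (hm : m ≤ n) {t t' : Mon (MVar n)} (hs : SpecEq t t')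
    (ht : Tok m (conf n t)) (ht' : Tok m (conf n t'))
    (hSF : ∀ i, m < i → (conf n t).S i = (conf n t').S i ∧ (conf n t).F i = (conf n t').F i)
    (hC : ∀ i, m ≤ i → ∀ j, (conf n t).C j i = (conf n t').C j i)
    (hB : ∀ i, m < i → ∀ j, (conf n t).B j i = (conf n t').B j i)
    (i : Fin 4) (k : ℕ) (hCi : 1 ≤ (conf n t).C i m)
    (hBi : (conf n t).B i m = (conf n t').B i m + k)
    (hBm : ∀ j, j ≠ i → (conf n t).B j m = (conf n t').B j m)
    (h : Rsh m k (conf n t) (conf n t')) : Sab n a b t ↔ Sab n a b t' := by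
  rcases hm.lt_or_eq with hm | rfl
  · refine topA' (m := m + 1) hm hs (ht.mono (by omega)) (ht'.mono (by omega))
      (fun i hi => hSF i (by omega))
      (fun i hi j => ⟨hC i (by omega) j, hB i (by omega) j⟩) ?_
    exact Rl_shift ht ht' (hSF _ (by omega)) i (hC m le_rfl) hCi hBi hBm h
  · obtain ⟨h1, h2, h3, h4, h5, h6, h7⟩ := hs
    rw [Sab_tok ht, Sab_tok ht']
    simp only [h1, h2, h3, h4, h5, h6, h7]
    refine and_congr_right fun _ => and_congr_right fun _ => and_congr_right fun _ =>
      and_congr_right fun _ => and_congr_right fun _ => ?_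
    have hc := hC m le_rfl
    simp only [hc] at hCi ⊢
    have h0 := hBm 0
    have h1 := hBm 1
    have h2 := hBm 2
    constructor
    · rintro ⟨N, hN, c0, c1, c2, c3, hrest⟩
      obtain rfl : i = 3 := by clear hBi hBm; fin_cases i <;> simp at hCi ⊢ <;> omega
      obtain ⟨M, rfl, hM⟩ := (h N).1 hN
      simp at h0 h1 h2
      exact ⟨M, hM, c0, c1, c2, c3, by omega⟩
    · rintro ⟨M, hM, c0, c1, c2, c3, hrest⟩
      obtain rfl : i = 3 := by clear hBi hBm; fin_cases i <;> simp at hCi ⊢ <;> omega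
      simp at h0 h1 h2
      exact ⟨M + k, (h _).2 ⟨M, rfl, hM⟩, c0, c1, c2, c3, by omega⟩

lemma Zl_congr {m : ℕ} {t t' : Conf} (h : ∀ k < m, t.S k = t'.S k ∧ t.F k = t'.F k ∧
    ∀ j, t.C j k = t'.C j k ∧ t.B j k = t'.B j k) : Zl m t ↔ Zl m t' := by
  unfold Zl
  refine forall_congr' fun k => forall_congr' fun hk => ?_
  obtain ⟨h1, h2, h3⟩ := h k hk
  simp only [h1, h2, h3]

/-- Closedness of a set of monomials under a binomial. -/
def Clo {n : ℕ} (Q : Mon (MVar n) → Prop) (u v : Mon (MVar n)) : Prop :=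
  ∀ w, Q (u + w) ↔ Q (v + w)

lemma Sab_bar {n a b : ℕ} {t : Mon (MVar n)} (i : Fin (n+1))
    (h : t (vS true i) ≠ 0 ∨ t (vF true i) ≠ 0) : ¬ Sab n a b t := by
  rintro ⟨-, h2, -⟩
  have := h2 i
  tauto


/-- Weight of a variable in the `S` component. -/
def wS {n : ℕ} : MVar n → ℕ → ℕ
  | vS false i, m => if (i : ℕ) = m then 1 else 0
  | _, _ => 0
/-- Weight of a variable in the `F` component. -/
def wF {n : ℕ} : MVar n → ℕ → ℕ
  | vF false i, m => if (i : ℕ) = m then 1 else 0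
  | _, _ => 0
/-- Weight of a variable in the `C` component. -/
def wC {n : ℕ} : MVar n → Fin 4 → ℕ → ℕ
  | vC false j i, j', m => if j = j' ∧ (i : ℕ) = m then 1 else 0
  | _, _, _ => 0
/-- Weight of a variable in the `B` component. -/
def wB {n : ℕ} : MVar n → Fin 4 → ℕ → ℕ
  | vB false j i, j', m => if j = j' ∧ (i : ℕ) = m then 1 else 0
  | _, _, _ => 0

section confLemmas
variable {n : ℕ} (t u : Mon (MVar n)) (x : MVar n) (k m : ℕ) (j : Fin 4)

lemma conf_add_S : (conf n (t + u)).S m = (conf n t).S m + (conf n u).S m := by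
  simp only [conf]; split_ifs <;> simp
lemma conf_add_F : (conf n (t + u)).F m = (conf n t).F m + (conf n u).F m := by
  simp only [conf]; split_ifs <;> simp
lemma conf_add_C : (conf n (t + u)).C j m = (conf n t).C j m + (conf n u).C j m := by
  simp only [conf]; split_ifs <;> simp
lemma conf_add_B : (conf n (t + u)).B j m = (conf n t).B j m + (conf n u).B j m := by
  simp only [conf]; split_ifs <;> simp

lemma conf_single_S : (conf n (Finsupp.single x k)).S m = k * wS x m := by
  simp only [conf]
  split_ifs with h
  · rcases x with _|_|_|_|_|_|⟨_|_, i⟩|⟨_|_, i⟩|⟨_|_, _, i⟩|⟨_|_, _, i⟩|⟨_|_, _, i⟩ <;>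
      simp [wS, Finsupp.single_apply, Fin.ext_iff]
  · rcases x with _|_|_|_|_|_|⟨_|_, i⟩|⟨_|_, i⟩|⟨_|_, _, i⟩|⟨_|_, _, i⟩|⟨_|_, _, i⟩ <;>
      simp [wS] <;> omega
lemma conf_single_F : (conf n (Finsupp.single x k)).F m = k * wF x m := by
  simp only [conf]
  split_ifs with h
  · rcases x with _|_|_|_|_|_|⟨_|_, i⟩|⟨_|_, i⟩|⟨_|_, _, i⟩|⟨_|_, _, i⟩|⟨_|_, _, i⟩ <;>
      simp [wF, Finsupp.single_apply, Fin.ext_iff]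
  · rcases x with _|_|_|_|_|_|⟨_|_, i⟩|⟨_|_, i⟩|⟨_|_, _, i⟩|⟨_|_, _, i⟩|⟨_|_, _, i⟩ <;>
      simp [wF] <;> omega
lemma conf_single_C : (conf n (Finsupp.single x k)).C j m = k * wC x j m := by
  simp only [conf]
  split_ifs with h
  · rcases x with _|_|_|_|_|_|⟨_|_, i⟩|⟨_|_, i⟩|⟨_|_, _, i⟩|⟨_|_, _, i⟩|⟨_|_, _, i⟩ <;>
      simp [wC, Finsupp.single_apply, Fin.ext_iff]
  · rcases x with _|_|_|_|_|_|⟨_|_, i⟩|⟨_|_, i⟩|⟨_|_, _, i⟩|⟨_|_, _, i⟩|⟨_|_, _, i⟩ <;>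
      simp [wC] <;> omega
lemma conf_single_B : (conf n (Finsupp.single x k)).B j m = k * wB x j m := by
  simp only [conf]
  split_ifs with h
  · rcases x with _|_|_|_|_|_|⟨_|_, i⟩|⟨_|_, i⟩|⟨_|_, _, i⟩|⟨_|_, _, i⟩|⟨_|_, _, i⟩ <;>
      simp [wB, Finsupp.single_apply, Fin.ext_iff]
  · rcases x with _|_|_|_|_|_|⟨_|_, i⟩|⟨_|_, i⟩|⟨_|_, _, i⟩|⟨_|_, _, i⟩|⟨_|_, _, i⟩ <;>
      simp [wB] <;> omega
end confLemmas

lemma clo_P0 {n a b : ℕ} (j : Fin 4) :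
    Clo (Sab n a b) (Finsupp.single (vB false j 0) 2 + Finsupp.single (vC false j 0) 1 +
      Finsupp.single (vF false 0) 1)
      (Finsupp.single (vC false j 0) 1 + Finsupp.single (vS false 0) 1) := by
  intro w
  refine topB (m := 0) (Nat.zero_le _) ?_ ?_ ?_ ?_ ?_ ?_ j 2 ?_ ?_ ?_ ?_
  · simp [SpecEq]
  · refine ⟨0, le_rfl, Or.inr ?_⟩
    simp [conf_add_F, conf_single_F, wF]
  · refine ⟨0, le_rfl, Or.inl ?_⟩
    simp [conf_add_S, conf_single_S, wS]
  · intro i hi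
    simp [conf_add_S, conf_single_S, wS, conf_add_F, conf_single_F, wF, hi.ne]
  · intro i hi j
    simp [conf_add_C, conf_single_C, wC]
  · intro i hi j
    simp [conf_add_B, conf_single_B, wB, hi.ne]
  · simp [conf_add_C, conf_single_C, wC]
  · simp [conf_add_B, conf_single_B, wB]; omega
  · intro i hi
    simp [conf_add_B, conf_single_B, wB, hi.symm]
  · intro N
    simp [Rl, conf_add_S, conf_single_S, wS, conf_add_F, conf_single_F, wF]
    omega


lemma Zl_succ {m : ℕ} {t : Conf} : Zl (m+1) t ↔ Zl m t ∧ t.S m = 0 ∧ t.F m = 0 ∧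
    ∀ j, t.C j m = 0 ∧ t.B j m = 0 := by
  unfold Zl
  simp only [Nat.forall_lt_succ_right]

lemma Zl_add {n m : ℕ} {u w : Mon (MVar n)} (hu : Zl m (conf n u)) :
    Zl m (conf n (u + w)) ↔ Zl m (conf n w) := by
  refine Zl_congr fun k hk => ?_
  obtain ⟨h1, h2, h3⟩ := hu k hk
  simp [conf_add_S, conf_add_F, conf_add_C, conf_add_B, h1, h2, h3]

lemma Tok.add {n m : ℕ} {u : Mon (MVar n)} (hu : Tok m (conf n u)) (w : Mon (MVar n)) :
    Tok m (conf n (u + w)) := by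
  obtain ⟨k, hk, h⟩ := hu
  refine ⟨k, hk, ?_⟩
  rw [conf_add_S, conf_add_F]
  omega

lemma SpecEq.add {n : ℕ} {u v : Mon (MVar n)} (h : SpecEq u v) (w : Mon (MVar n)) :
    SpecEq (u + w) (v + w) := by
  obtain ⟨h1, h2, h3, h4, h5, h6, h7⟩ := h
  simp [SpecEq, h1, h2, h3, h4, h5, h6, h7]

lemma clo_mid {n a b : ℕ} (i : Fin n) {u v : Mon (MVar n)} (hs : SpecEq u v)
    (tu : Tok (i + 1) (conf n u)) (tv : Tok (i + 1) (conf n v))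
    (hSF : ∀ k : ℕ, (i : ℕ) + 1 < k → (conf n u).S k = (conf n v).S k ∧
      (conf n u).F k = (conf n v).F k)
    (hCB : ∀ k : ℕ, (i : ℕ) + 1 ≤ k → ∀ j, (conf n u).C j k = (conf n v).C j k ∧
      (conf n u).B j k = (conf n v).B j k)
    (h : ∀ w N, Rl (i + 1) (conf n (u + w)) N ↔ Rl (i + 1) (conf n (v + w)) N) :
    Clo (Sab n a b) u v := by
  intro w
  refine topA' (m := i + 1) i.2 (hs.add w) (tu.add w) (tv.add w) ?_ ?_ (h w)
  · intro k hk
    simp [conf_add_S, conf_add_F, hSF k hk]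
  · intro k hk j
    simp [conf_add_C, conf_add_B, hCB k hk]

section Pm
variable {n a b : ℕ} (i : Fin n)

lemma clo_P1 : Clo (Sab n a b)
    (Finsupp.single (vQ false 0 i.succ) 1 + Finsupp.single (vC false 0 i.castSucc) 1 + Finsupp.single (vS false i.castSucc) 1)
    (Finsupp.single (vS false i.succ) 1) := by
  have hu0 : 1 ≤ (conf n (Finsupp.single (vQ false 0 i.succ) 1 + Finsupp.single (vC false 0 i.castSucc) 1 + Finsupp.single (vS false i.castSucc) 1)).S i := by
    simp [conf_add_S, conf_single_S, wS]
  have hv0 : 1 ≤ (conf n (Finsupp.single (vS false i.succ) 1)).S (i + 1) := by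
    simp [conf_add_S, conf_single_S, wS]
  have hzu : Zl i (conf n (Finsupp.single (vQ false 0 i.succ) 1 + Finsupp.single (vC false 0 i.castSucc) 1 + Finsupp.single (vS false i.castSucc) 1)) := by
    intro k hk
    have h1 : (i : ℕ) ≠ k := by omega
    have h2 : (i : ℕ) + 1 ≠ k := by omega
    simp [conf_add_S, conf_single_S, wS, conf_add_F, conf_single_F, wF, conf_add_C,
        conf_single_C, wC, conf_add_B, conf_single_B, wB, h1]
  have hzv : Zl i (conf n (Finsupp.single (vS false i.succ) 1)) := by
    intro k hk
    have h1 : (i : ℕ) ≠ k := by omega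
    have h2 : (i : ℕ) + 1 ≠ k := by omega
    simp [conf_add_S, conf_single_S, wS, conf_add_F, conf_single_F, wF, conf_add_C,
        conf_single_C, wC, conf_add_B, conf_single_B, wB, h1, h2]
  refine clo_mid i ?_ ⟨i, by omega, Or.inl hu0⟩ ⟨(i + 1), by omega, Or.inl hv0⟩ ?_ ?_ ?_
  · simp [SpecEq]
  · intro k hk
    have h1 : (i : ℕ) ≠ k := by omega
    have h2 : (i : ℕ) + 1 ≠ k := by omega
    simp [conf_add_S, conf_single_S, wS, conf_add_F, conf_single_F, wF, h1, h2]
  · intro k hk j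
    have h1 : (i : ℕ) ≠ k := by omega
    simp [conf_add_C, conf_single_C, wC, conf_add_B, conf_single_B, wB, h1]
  · intro w N
    have hu : 1 ≤ (conf n ((Finsupp.single (vQ false 0 i.succ) 1 + Finsupp.single (vC false 0 i.castSucc) 1 + Finsupp.single (vS false i.castSucc) 1) + w)).S i := by
      rw [conf_add_S]; omega
    have hv : 1 ≤ (conf n ((Finsupp.single (vS false i.succ) 1) + w)).S (i + 1) := by
      rw [conf_add_S]; omega
    rw [Rl_succ_S hu, Rl_S hv, Zl_succ, Zl_add hzu, Zl_add hzv]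
    generalize Zl i (conf n w) = Z
    simp [Lv, conf_add_S, conf_single_S, wS, conf_add_F, conf_single_F, wF, conf_add_C,
        conf_single_C, wC, conf_add_B, conf_single_B, wB, Fin.forall_fin_succ, en_succ]
    generalize (conf n w).S i = S0
    generalize (conf n w).F i = F0
    generalize (conf n w).C 0 i = C0
    generalize (conf n w).C 1 i = C1
    generalize (conf n w).C 2 i = C2
    generalize (conf n w).C 3 i = C3
    generalize (conf n w).B 0 i = B0
    generalize (conf n w).B 1 i = B1
    generalize (conf n w).B 2 i = B2
    generalize (conf n w).B 3 i = B3
    generalize en i = E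
    intro _ _
    constructor
    · rintro ⟨rfl, rfl, hz, rfl, rfl, rfl, rfl, rfl, rfl, ⟨rfl, rfl⟩, rfl⟩
      simpa using hz
    · rintro ⟨⟨hz, rfl, rfl, ⟨rfl, rfl⟩, ⟨rfl, rfl⟩, ⟨rfl, rfl⟩, rfl, rfl⟩, rfl⟩
      simpa using hz

lemma clo_P2 : Clo (Sab n a b)
    (Finsupp.single (vQ false 1 i.succ) 1 + Finsupp.single (vC false 1 i.castSucc) 1 + Finsupp.single (vS false i.castSucc) 1)
    (Finsupp.single (vQ false 0 i.succ) 1 + Finsupp.single (vB false 0 i.castSucc) 1 + Finsupp.single (vC false 0 i.castSucc) 1 + Finsupp.single (vF false i.castSucc) 1) := by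
  have hu0 : 1 ≤ (conf n (Finsupp.single (vQ false 1 i.succ) 1 + Finsupp.single (vC false 1 i.castSucc) 1 + Finsupp.single (vS false i.castSucc) 1)).S i := by
    simp [conf_add_S, conf_single_S, wS]
  have hv0 : 1 ≤ (conf n (Finsupp.single (vQ false 0 i.succ) 1 + Finsupp.single (vB false 0 i.castSucc) 1 + Finsupp.single (vC false 0 i.castSucc) 1 + Finsupp.single (vF false i.castSucc) 1)).F i := by
    simp [conf_add_F, conf_single_F, wF]
  have hzu : Zl i (conf n (Finsupp.single (vQ false 1 i.succ) 1 + Finsupp.single (vC false 1 i.castSucc) 1 + Finsupp.single (vS false i.castSucc) 1)) := by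
    intro k hk
    have h1 : (i : ℕ) ≠ k := by omega
    have h2 : (i : ℕ) + 1 ≠ k := by omega
    simp [conf_add_S, conf_single_S, wS, conf_add_F, conf_single_F, wF, conf_add_C,
        conf_single_C, wC, conf_add_B, conf_single_B, wB, h1]
  have hzv : Zl i (conf n (Finsupp.single (vQ false 0 i.succ) 1 + Finsupp.single (vB false 0 i.castSucc) 1 + Finsupp.single (vC false 0 i.castSucc) 1 + Finsupp.single (vF false i.castSucc) 1)) := by
    intro k hk
    have h1 : (i : ℕ) ≠ k := by omega
    have h2 : (i : ℕ) + 1 ≠ k := by omega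
    simp [conf_add_S, conf_single_S, wS, conf_add_F, conf_single_F, wF, conf_add_C,
        conf_single_C, wC, conf_add_B, conf_single_B, wB, h1, h2]
  refine clo_mid i ?_ ⟨i, by omega, Or.inl hu0⟩ ⟨i, by omega, Or.inr hv0⟩ ?_ ?_ ?_
  · simp [SpecEq]
  · intro k hk
    have h1 : (i : ℕ) ≠ k := by omega
    have h2 : (i : ℕ) + 1 ≠ k := by omega
    simp [conf_add_S, conf_single_S, wS, conf_add_F, conf_single_F, wF, h1, h2]
  · intro k hk j
    have h1 : (i : ℕ) ≠ k := by omega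
    simp [conf_add_C, conf_single_C, wC, conf_add_B, conf_single_B, wB, h1]
  · intro w N
    have hu : 1 ≤ (conf n ((Finsupp.single (vQ false 1 i.succ) 1 + Finsupp.single (vC false 1 i.castSucc) 1 + Finsupp.single (vS false i.castSucc) 1) + w)).S i := by
      rw [conf_add_S]; omega
    have hv : 1 ≤ (conf n ((Finsupp.single (vQ false 0 i.succ) 1 + Finsupp.single (vB false 0 i.castSucc) 1 + Finsupp.single (vC false 0 i.castSucc) 1 + Finsupp.single (vF false i.castSucc) 1) + w)).F i := by
      rw [conf_add_F]; omega
    rw [Rl_succ_S hu, Rl_succ_F hv, Zl_add hzu, Zl_add hzv]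
    generalize Zl i (conf n w) = Z
    simp [Lv, conf_add_S, conf_single_S, wS, conf_add_F, conf_single_F, wF, conf_add_C,
        conf_single_C, wC, conf_add_B, conf_single_B, wB, Fin.forall_fin_succ, en_succ]
    generalize (conf n w).S i = S0
    generalize (conf n w).F i = F0
    generalize (conf n w).C 0 i = C0
    generalize (conf n w).C 1 i = C1
    generalize (conf n w).C 2 i = C2
    generalize (conf n w).C 3 i = C3
    generalize (conf n w).B 0 i = B0
    generalize (conf n w).B 1 i = B1
    generalize (conf n w).B 2 i = B2
    generalize (conf n w).B 3 i = B3
    generalize en i = E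
    intros
    omega

lemma clo_P3 : Clo (Sab n a b)
    (Finsupp.single (vQ false 2 i.succ) 1 + Finsupp.single (vC false 2 i.castSucc) 1 + Finsupp.single (vF false i.castSucc) 1)
    (Finsupp.single (vQ false 1 i.succ) 1 + Finsupp.single (vC false 1 i.castSucc) 1 + Finsupp.single (vF false i.castSucc) 1) := by
  have hu0 : 1 ≤ (conf n (Finsupp.single (vQ false 2 i.succ) 1 + Finsupp.single (vC false 2 i.castSucc) 1 + Finsupp.single (vF false i.castSucc) 1)).F i := by
    simp [conf_add_F, conf_single_F, wF]
  have hv0 : 1 ≤ (conf n (Finsupp.single (vQ false 1 i.succ) 1 + Finsupp.single (vC false 1 i.castSucc) 1 + Finsupp.single (vF false i.castSucc) 1)).F i := by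
    simp [conf_add_F, conf_single_F, wF]
  have hzu : Zl i (conf n (Finsupp.single (vQ false 2 i.succ) 1 + Finsupp.single (vC false 2 i.castSucc) 1 + Finsupp.single (vF false i.castSucc) 1)) := by
    intro k hk
    have h1 : (i : ℕ) ≠ k := by omega
    have h2 : (i : ℕ) + 1 ≠ k := by omega
    simp [conf_add_S, conf_single_S, wS, conf_add_F, conf_single_F, wF, conf_add_C,
        conf_single_C, wC, conf_add_B, conf_single_B, wB, h1]
  have hzv : Zl i (conf n (Finsupp.single (vQ false 1 i.succ) 1 + Finsupp.single (vC false 1 i.castSucc) 1 + Finsupp.single (vF false i.castSucc) 1)) := by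
    intro k hk
    have h1 : (i : ℕ) ≠ k := by omega
    have h2 : (i : ℕ) + 1 ≠ k := by omega
    simp [conf_add_S, conf_single_S, wS, conf_add_F, conf_single_F, wF, conf_add_C,
        conf_single_C, wC, conf_add_B, conf_single_B, wB, h1, h2]
  refine clo_mid i ?_ ⟨i, by omega, Or.inr hu0⟩ ⟨i, by omega, Or.inr hv0⟩ ?_ ?_ ?_
  · simp [SpecEq]
  · intro k hk
    have h1 : (i : ℕ) ≠ k := by omega
    have h2 : (i : ℕ) + 1 ≠ k := by omega
    simp [conf_add_S, conf_single_S, wS, conf_add_F, conf_single_F, wF, h1, h2]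
  · intro k hk j
    have h1 : (i : ℕ) ≠ k := by omega
    simp [conf_add_C, conf_single_C, wC, conf_add_B, conf_single_B, wB, h1]
  · intro w N
    have hu : 1 ≤ (conf n ((Finsupp.single (vQ false 2 i.succ) 1 + Finsupp.single (vC false 2 i.castSucc) 1 + Finsupp.single (vF false i.castSucc) 1) + w)).F i := by
      rw [conf_add_F]; omega
    have hv : 1 ≤ (conf n ((Finsupp.single (vQ false 1 i.succ) 1 + Finsupp.single (vC false 1 i.castSucc) 1 + Finsupp.single (vF false i.castSucc) 1) + w)).F i := by
      rw [conf_add_F]; omega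
    rw [Rl_succ_F hu, Rl_succ_F hv, Zl_add hzu, Zl_add hzv]
    generalize Zl i (conf n w) = Z
    simp [Lv, conf_add_S, conf_single_S, wS, conf_add_F, conf_single_F, wF, conf_add_C,
        conf_single_C, wC, conf_add_B, conf_single_B, wB, Fin.forall_fin_succ, en_succ]
    generalize (conf n w).S i = S0
    generalize (conf n w).F i = F0
    generalize (conf n w).C 0 i = C0
    generalize (conf n w).C 1 i = C1
    generalize (conf n w).C 2 i = C2
    generalize (conf n w).C 3 i = C3
    generalize (conf n w).B 0 i = B0
    generalize (conf n w).B 1 i = B1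
    generalize (conf n w).B 2 i = B2
    generalize (conf n w).B 3 i = B3
    generalize en i = E
    intros
    omega

lemma clo_P4 : Clo (Sab n a b)
    (Finsupp.single (vQ false 2 i.succ) 1 + Finsupp.single (vB false 0 i.castSucc) 1 + Finsupp.single (vC false 2 i.castSucc) 1 + Finsupp.single (vS false i.castSucc) 1)
    (Finsupp.single (vQ false 1 i.succ) 1 + Finsupp.single (vB false 3 i.castSucc) 1 + Finsupp.single (vC false 1 i.castSucc) 1 + Finsupp.single (vS false i.castSucc) 1) := by
  have hu0 : 1 ≤ (conf n (Finsupp.single (vQ false 2 i.succ) 1 + Finsupp.single (vB false 0 i.castSucc) 1 + Finsupp.single (vC false 2 i.castSucc) 1 + Finsupp.single (vS false i.castSucc) 1)).S i := by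
    simp [conf_add_S, conf_single_S, wS]
  have hv0 : 1 ≤ (conf n (Finsupp.single (vQ false 1 i.succ) 1 + Finsupp.single (vB false 3 i.castSucc) 1 + Finsupp.single (vC false 1 i.castSucc) 1 + Finsupp.single (vS false i.castSucc) 1)).S i := by
    simp [conf_add_S, conf_single_S, wS]
  have hzu : Zl i (conf n (Finsupp.single (vQ false 2 i.succ) 1 + Finsupp.single (vB false 0 i.castSucc) 1 + Finsupp.single (vC false 2 i.castSucc) 1 + Finsupp.single (vS false i.castSucc) 1)) := by
    intro k hk
    have h1 : (i : ℕ) ≠ k := by omega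
    have h2 : (i : ℕ) + 1 ≠ k := by omega
    simp [conf_add_S, conf_single_S, wS, conf_add_F, conf_single_F, wF, conf_add_C,
        conf_single_C, wC, conf_add_B, conf_single_B, wB, h1]
  have hzv : Zl i (conf n (Finsupp.single (vQ false 1 i.succ) 1 + Finsupp.single (vB false 3 i.castSucc) 1 + Finsupp.single (vC false 1 i.castSucc) 1 + Finsupp.single (vS false i.castSucc) 1)) := by
    intro k hk
    have h1 : (i : ℕ) ≠ k := by omega
    have h2 : (i : ℕ) + 1 ≠ k := by omega
    simp [conf_add_S, conf_single_S, wS, conf_add_F, conf_single_F, wF, conf_add_C,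
        conf_single_C, wC, conf_add_B, conf_single_B, wB, h1, h2]
  refine clo_mid i ?_ ⟨i, by omega, Or.inl hu0⟩ ⟨i, by omega, Or.inl hv0⟩ ?_ ?_ ?_
  · simp [SpecEq]
  · intro k hk
    have h1 : (i : ℕ) ≠ k := by omega
    have h2 : (i : ℕ) + 1 ≠ k := by omega
    simp [conf_add_S, conf_single_S, wS, conf_add_F, conf_single_F, wF, h1, h2]
  · intro k hk j
    have h1 : (i : ℕ) ≠ k := by omega
    simp [conf_add_C, conf_single_C, wC, conf_add_B, conf_single_B, wB, h1]
  · intro w N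
    have hu : 1 ≤ (conf n ((Finsupp.single (vQ false 2 i.succ) 1 + Finsupp.single (vB false 0 i.castSucc) 1 + Finsupp.single (vC false 2 i.castSucc) 1 + Finsupp.single (vS false i.castSucc) 1) + w)).S i := by
      rw [conf_add_S]; omega
    have hv : 1 ≤ (conf n ((Finsupp.single (vQ false 1 i.succ) 1 + Finsupp.single (vB false 3 i.castSucc) 1 + Finsupp.single (vC false 1 i.castSucc) 1 + Finsupp.single (vS false i.castSucc) 1) + w)).S i := by
      rw [conf_add_S]; omega
    rw [Rl_succ_S hu, Rl_succ_S hv, Zl_add hzu, Zl_add hzv]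
    generalize Zl i (conf n w) = Z
    simp [Lv, conf_add_S, conf_single_S, wS, conf_add_F, conf_single_F, wF, conf_add_C,
        conf_single_C, wC, conf_add_B, conf_single_B, wB, Fin.forall_fin_succ, en_succ]
    generalize (conf n w).S i = S0
    generalize (conf n w).F i = F0
    generalize (conf n w).C 0 i = C0
    generalize (conf n w).C 1 i = C1
    generalize (conf n w).C 2 i = C2
    generalize (conf n w).C 3 i = C3
    generalize (conf n w).B 0 i = B0
    generalize (conf n w).B 1 i = B1
    generalize (conf n w).B 2 i = B2
    generalize (conf n w).B 3 i = B3
    generalize en i = E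
    intros
    simp only [mul_add, mul_one]
    omega

lemma clo_P5 : Clo (Sab n a b)
    (Finsupp.single (vQ false 3 i.succ) 1 + Finsupp.single (vB false 3 i.castSucc) 1 + Finsupp.single (vC false 3 i.castSucc) 1 + Finsupp.single (vF false i.castSucc) 1)
    (Finsupp.single (vQ false 2 i.succ) 1 + Finsupp.single (vC false 2 i.castSucc) 1 + Finsupp.single (vS false i.castSucc) 1) := by
  have hu0 : 1 ≤ (conf n (Finsupp.single (vQ false 3 i.succ) 1 + Finsupp.single (vB false 3 i.castSucc) 1 + Finsupp.single (vC false 3 i.castSucc) 1 + Finsupp.single (vF false i.castSucc) 1)).F i := by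
    simp [conf_add_F, conf_single_F, wF]
  have hv0 : 1 ≤ (conf n (Finsupp.single (vQ false 2 i.succ) 1 + Finsupp.single (vC false 2 i.castSucc) 1 + Finsupp.single (vS false i.castSucc) 1)).S i := by
    simp [conf_add_S, conf_single_S, wS]
  have hzu : Zl i (conf n (Finsupp.single (vQ false 3 i.succ) 1 + Finsupp.single (vB false 3 i.castSucc) 1 + Finsupp.single (vC false 3 i.castSucc) 1 + Finsupp.single (vF false i.castSucc) 1)) := by
    intro k hk
    have h1 : (i : ℕ) ≠ k := by omega
    have h2 : (i : ℕ) + 1 ≠ k := by omega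
    simp [conf_add_S, conf_single_S, wS, conf_add_F, conf_single_F, wF, conf_add_C,
        conf_single_C, wC, conf_add_B, conf_single_B, wB, h1]
  have hzv : Zl i (conf n (Finsupp.single (vQ false 2 i.succ) 1 + Finsupp.single (vC false 2 i.castSucc) 1 + Finsupp.single (vS false i.castSucc) 1)) := by
    intro k hk
    have h1 : (i : ℕ) ≠ k := by omega
    have h2 : (i : ℕ) + 1 ≠ k := by omega
    simp [conf_add_S, conf_single_S, wS, conf_add_F, conf_single_F, wF, conf_add_C,
        conf_single_C, wC, conf_add_B, conf_single_B, wB, h1, h2]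
  refine clo_mid i ?_ ⟨i, by omega, Or.inr hu0⟩ ⟨i, by omega, Or.inl hv0⟩ ?_ ?_ ?_
  · simp [SpecEq]
  · intro k hk
    have h1 : (i : ℕ) ≠ k := by omega
    have h2 : (i : ℕ) + 1 ≠ k := by omega
    simp [conf_add_S, conf_single_S, wS, conf_add_F, conf_single_F, wF, h1, h2]
  · intro k hk j
    have h1 : (i : ℕ) ≠ k := by omega
    simp [conf_add_C, conf_single_C, wC, conf_add_B, conf_single_B, wB, h1]
  · intro w N
    have hu : 1 ≤ (conf n ((Finsupp.single (vQ false 3 i.succ) 1 + Finsupp.single (vB false 3 i.castSucc) 1 + Finsupp.single (vC false 3 i.castSucc) 1 + Finsupp.single (vF false i.castSucc) 1) + w)).F i := by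
      rw [conf_add_F]; omega
    have hv : 1 ≤ (conf n ((Finsupp.single (vQ false 2 i.succ) 1 + Finsupp.single (vC false 2 i.castSucc) 1 + Finsupp.single (vS false i.castSucc) 1) + w)).S i := by
      rw [conf_add_S]; omega
    rw [Rl_succ_F hu, Rl_succ_S hv, Zl_add hzu, Zl_add hzv]
    generalize Zl i (conf n w) = Z
    simp [Lv, conf_add_S, conf_single_S, wS, conf_add_F, conf_single_F, wF, conf_add_C,
        conf_single_C, wC, conf_add_B, conf_single_B, wB, Fin.forall_fin_succ, en_succ]
    generalize (conf n w).S i = S0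
    generalize (conf n w).F i = F0
    generalize (conf n w).C 0 i = C0
    generalize (conf n w).C 1 i = C1
    generalize (conf n w).C 2 i = C2
    generalize (conf n w).C 3 i = C3
    generalize (conf n w).B 0 i = B0
    generalize (conf n w).B 1 i = B1
    generalize (conf n w).B 2 i = B2
    generalize (conf n w).B 3 i = B3
    generalize en i = E
    intros
    have key : B0 + B3 + 1 = E → E * E = E * B0 + E * B3 + E := by
      intro h
      calc E * E = E * (B0 + B3 + 1) := by rw [h]
        _ = _ := by ring
    constructor
    · rintro ⟨h1, h2, h3, h4⟩
      have := key (by omega)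
      omega
    · rintro ⟨⟨h1, h2⟩, h3, h4⟩
      have := key h3
      omega

lemma clo_P6 : Clo (Sab n a b)
    (Finsupp.single (vQ false 3 i.succ) 1 + Finsupp.single (vC false 3 i.castSucc) 1 + Finsupp.single (vS false i.castSucc) 1)
    (Finsupp.single (vF false i.succ) 1) := by
  have hu0 : 1 ≤ (conf n (Finsupp.single (vQ false 3 i.succ) 1 + Finsupp.single (vC false 3 i.castSucc) 1 + Finsupp.single (vS false i.castSucc) 1)).S i := by
    simp [conf_add_S, conf_single_S, wS]
  have hv0 : 1 ≤ (conf n (Finsupp.single (vF false i.succ) 1)).F (i + 1) := by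
    simp [conf_add_F, conf_single_F, wF]
  have hzu : Zl i (conf n (Finsupp.single (vQ false 3 i.succ) 1 + Finsupp.single (vC false 3 i.castSucc) 1 + Finsupp.single (vS false i.castSucc) 1)) := by
    intro k hk
    have h1 : (i : ℕ) ≠ k := by omega
    have h2 : (i : ℕ) + 1 ≠ k := by omega
    simp [conf_add_S, conf_single_S, wS, conf_add_F, conf_single_F, wF, conf_add_C,
        conf_single_C, wC, conf_add_B, conf_single_B, wB, h1]
  have hzv : Zl i (conf n (Finsupp.single (vF false i.succ) 1)) := by
    intro k hk
    have h1 : (i : ℕ) ≠ k := by omega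
    have h2 : (i : ℕ) + 1 ≠ k := by omega
    simp [conf_add_S, conf_single_S, wS, conf_add_F, conf_single_F, wF, conf_add_C,
        conf_single_C, wC, conf_add_B, conf_single_B, wB, h1, h2]
  refine clo_mid i ?_ ⟨i, by omega, Or.inl hu0⟩ ⟨(i + 1), by omega, Or.inr hv0⟩ ?_ ?_ ?_
  · simp [SpecEq]
  · intro k hk
    have h1 : (i : ℕ) ≠ k := by omega
    have h2 : (i : ℕ) + 1 ≠ k := by omega
    simp [conf_add_S, conf_single_S, wS, conf_add_F, conf_single_F, wF, h1, h2]
  · intro k hk j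
    have h1 : (i : ℕ) ≠ k := by omega
    simp [conf_add_C, conf_single_C, wC, conf_add_B, conf_single_B, wB, h1]
  · intro w N
    have hu : 1 ≤ (conf n ((Finsupp.single (vQ false 3 i.succ) 1 + Finsupp.single (vC false 3 i.castSucc) 1 + Finsupp.single (vS false i.castSucc) 1) + w)).S i := by
      rw [conf_add_S]; omega
    have hv : 1 ≤ (conf n ((Finsupp.single (vF false i.succ) 1) + w)).F (i + 1) := by
      rw [conf_add_F]; omega
    rw [Rl_succ_S hu, Rl_F hv, Zl_succ, Zl_add hzu, Zl_add hzv]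
    generalize Zl i (conf n w) = Z
    simp [Lv, conf_add_S, conf_single_S, wS, conf_add_F, conf_single_F, wF, conf_add_C,
        conf_single_C, wC, conf_add_B, conf_single_B, wB, Fin.forall_fin_succ, en_succ]
    generalize (conf n w).S i = S0
    generalize (conf n w).F i = F0
    generalize (conf n w).C 0 i = C0
    generalize (conf n w).C 1 i = C1
    generalize (conf n w).C 2 i = C2
    generalize (conf n w).C 3 i = C3
    generalize (conf n w).B 0 i = B0
    generalize (conf n w).B 1 i = B1
    generalize (conf n w).B 2 i = B2
    generalize (conf n w).B 3 i = B3
    generalize en i = E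
    intro _ _
    constructor
    · rintro ⟨rfl, rfl, hz, rfl, rfl, rfl, rfl, rfl, rfl, ⟨rfl, rfl⟩, h⟩
      simpa using ⟨hz, h⟩
    · rintro ⟨⟨hz, rfl, rfl, ⟨rfl, rfl⟩, ⟨rfl, rfl⟩, ⟨rfl, rfl⟩, rfl, rfl⟩, rfl⟩
      simpa using hz

lemma clo_P7 (j : Fin 4) : Clo (Sab n a b)
    (Finsupp.single (vQ false 1 i.succ) 1 + Finsupp.single (vB false 2 i.castSucc) 1 + Finsupp.single (vB false j i.succ) 1 + Finsupp.single (vC false j i.succ) 1 + Finsupp.single (vF false i.castSucc) 1)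
    (Finsupp.single (vQ false 1 i.succ) 1 + Finsupp.single (vB false 1 i.castSucc) 1 + Finsupp.single (vC false j i.succ) 1 + Finsupp.single (vF false i.castSucc) 1) := by
  intro w
  have hu : 1 ≤ (conf n ((Finsupp.single (vQ false 1 i.succ) 1 + Finsupp.single (vB false 2 i.castSucc) 1 + Finsupp.single (vB false j i.succ) 1 + Finsupp.single (vC false j i.succ) 1 + Finsupp.single (vF false i.castSucc) 1) + w)).F i := by
    simp [conf_add_F, conf_single_F, wF]
  have hv : 1 ≤ (conf n ((Finsupp.single (vQ false 1 i.succ) 1 + Finsupp.single (vB false 1 i.castSucc) 1 + Finsupp.single (vC false j i.succ) 1 + Finsupp.single (vF false i.castSucc) 1) + w)).F i := by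
    simp [conf_add_F, conf_single_F, wF]
  have hzu : Zl i (conf n (Finsupp.single (vQ false 1 i.succ) 1 + Finsupp.single (vB false 2 i.castSucc) 1 + Finsupp.single (vB false j i.succ) 1 + Finsupp.single (vC false j i.succ) 1 + Finsupp.single (vF false i.castSucc) 1)) := by
    intro k hk
    have h1 : (i : ℕ) ≠ k := by omega
    have h2 : (i : ℕ) + 1 ≠ k := by omega
    simp [conf_add_S, conf_single_S, wS, conf_add_F, conf_single_F, wF, conf_add_C,
        conf_single_C, wC, conf_add_B, conf_single_B, wB, h1, h2]
  have hzv : Zl i (conf n (Finsupp.single (vQ false 1 i.succ) 1 + Finsupp.single (vB false 1 i.castSucc) 1 + Finsupp.single (vC false j i.succ) 1 + Finsupp.single (vF false i.castSucc) 1)) := by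
    intro k hk
    have h1 : (i : ℕ) ≠ k := by omega
    have h2 : (i : ℕ) + 1 ≠ k := by omega
    simp [conf_add_S, conf_single_S, wS, conf_add_F, conf_single_F, wF, conf_add_C,
        conf_single_C, wC, conf_add_B, conf_single_B, wB, h1, h2]
  refine topB (m := i + 1) i.2 ?_ ⟨i, by omega, Or.inr hu⟩ ⟨i, by omega, Or.inr hv⟩ ?_ ?_ ?_
    j 1 ?_ ?_ ?_ ?_
  · simp [SpecEq]
  · intro k hk
    have h1 : (i : ℕ) ≠ k := by omega
    simp [conf_add_S, conf_single_S, wS, conf_add_F, conf_single_F, wF, h1]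
  · intro k hk j
    have h1 : (i : ℕ) ≠ k := by omega
    simp [conf_add_C, conf_single_C, wC]
  · intro k hk j
    have h1 : (i : ℕ) ≠ k := by omega
    have h2 : (i : ℕ) + 1 ≠ k := by omega
    simp [conf_add_B, conf_single_B, wB, h1, h2]
  · simp [conf_add_C, conf_single_C, wC]
  · simp [conf_add_B, conf_single_B, wB]; omega
  · intro k hk
    simp [conf_add_B, conf_single_B, wB, hk.symm]
  · intro N
    simp only [Rl_succ_F hu, Rl_succ_F hv, Zl_add hzu, Zl_add hzv]
    generalize Zl i (conf n w) = Z
    simp [Lv, conf_add_S, conf_single_S, wS, conf_add_F, conf_single_F, wF, conf_add_C,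
        conf_single_C, wC, conf_add_B, conf_single_B, wB]
    generalize (conf n w).S i = S0
    generalize (conf n w).F i = F0
    generalize (conf n w).C 0 i = C0
    generalize (conf n w).C 1 i = C1
    generalize (conf n w).C 2 i = C2
    generalize (conf n w).C 3 i = C3
    generalize (conf n w).B 0 i = B0
    generalize (conf n w).B 1 i = B1
    generalize (conf n w).B 2 i = B2
    generalize (conf n w).B 3 i = B3
    generalize en i = E
    constructor
    · rintro ⟨h1, h2, h3, h4, hz, h⟩
      refine ⟨N - 1, ?_, h1, h2, h3, h4, hz, ?_⟩
      · omega
      · omega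
    · rintro ⟨M, rfl, h1, h2, h3, h4, hz, h⟩
      refine ⟨h1, h2, h3, h4, hz, ?_⟩
      omega
end Pm

section GGclosed
variable {n a b : ℕ}

lemma not_Sab_S (hab : a + b < en n) {t : Mon (MVar n)} (h : t (vS false (Fin.last n)) ≠ 0) :
    ¬ Sab n a b t := by
  have hS : 1 ≤ (conf n t).S n := by
    simp only [conf, lt_add_iff_pos_right, Nat.lt_one_iff, pos_of_gt, dite_true]
    exact Nat.one_le_iff_ne_zero.2 h
  rw [Sab_tok ⟨n, le_rfl, Or.inl hS⟩]
  rintro ⟨-, -, h1, h2, -, N, hN, h3⟩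
  rw [Rl_S hS] at hN
  omega

lemma clo_G1 : Clo (Sab n a b)
    (Finsupp.single (vB false 3 (Fin.last n)) 1 + Finsupp.single vl 1 + Finsupp.single vb 1)
    (Finsupp.single vl 1 + Finsupp.single vc 1) := by
  intro w
  have hzu : Zl n (conf n (Finsupp.single (vB false 3 (Fin.last n)) 1 + Finsupp.single vl 1 +
      Finsupp.single vb 1)) := by
    intro k hk
    simp [conf_add_S, conf_single_S, wS, conf_add_F, conf_single_F, wF, conf_add_C,
        conf_single_C, wC, conf_add_B, conf_single_B, wB, hk.ne']
  have hzv : Zl n (conf n (Finsupp.single vl 1 + Finsupp.single vc 1)) := by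
    intro k hk
    simp [conf_add_S, conf_single_S, wS, conf_add_F, conf_single_F, wF, conf_add_C,
        conf_single_C, wC, conf_add_B, conf_single_B, wB]
  unfold Sab
  rw [Zl_add hzu, Zl_add hzv]
  generalize Zl n (conf n w) = Z
  simp [conf_add_S, conf_single_S, wS, conf_add_F, conf_single_F, wF, conf_add_C,
        conf_single_C, wC, conf_add_B, conf_single_B, wB, Finsupp.single_apply]
  refine fun _ _ => ?_
  constructor
  · rintro ⟨h1, h2, h3, hz, h4, h5, h6, h7, h8, h9, h10⟩
    exact ⟨by omega, by omega, h3, hz, h4, h5, h6, h7, h8, h9, by omega⟩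
  · rintro ⟨h1, h2, h3, hz, h4, h5, h6, h7, h8, h9, h10⟩
    exact ⟨by omega, by omega, h3, hz, h4, h5, h6, h7, h8, h9, by omega⟩

lemma clo_G2 : Clo (Sab n a b)
    (Finsupp.single (vB false 3 (Fin.last n)) 1 + Finsupp.single vl 1 + Finsupp.single vbb 1)
    (Finsupp.single vl 1 + Finsupp.single vcb 1) := by
  intro w
  have hzu : Zl n (conf n (Finsupp.single (vB false 3 (Fin.last n)) 1 + Finsupp.single vl 1 +
      Finsupp.single vbb 1)) := by
    intro k hk
    simp [conf_add_S, conf_single_S, wS, conf_add_F, conf_single_F, wF, conf_add_C,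
        conf_single_C, wC, conf_add_B, conf_single_B, wB, hk.ne']
  have hzv : Zl n (conf n (Finsupp.single vl 1 + Finsupp.single vcb 1)) := by
    intro k hk
    simp [conf_add_S, conf_single_S, wS, conf_add_F, conf_single_F, wF, conf_add_C,
        conf_single_C, wC, conf_add_B, conf_single_B, wB]
  unfold Sab
  rw [Zl_add hzu, Zl_add hzv]
  generalize Zl n (conf n w) = Z
  simp [conf_add_S, conf_single_S, wS, conf_add_F, conf_single_F, wF, conf_add_C,
        conf_single_C, wC, conf_add_B, conf_single_B, wB, Finsupp.single_apply]
  refine fun _ _ _ => ?_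
  constructor
  · rintro ⟨h2, h3, hz, h4, h5, h6, h7, h8, h9, h10⟩
    exact ⟨by omega, h3, hz, h4, h5, h6, h7, h8, h9, by omega⟩
  · rintro ⟨h2, h3, hz, h4, h5, h6, h7, h8, h9, h10⟩
    exact ⟨by omega, h3, hz, h4, h5, h6, h7, h8, h9, by omega⟩

lemma clo_G3 : Clo (Sab n a b)
    (Finsupp.single (vC false 3 (Fin.last n)) 1 + Finsupp.single (vF false (Fin.last n)) 1)
    (Finsupp.single vl 1) := by
  intro w
  have hzu : Zl n (conf n (Finsupp.single (vC false 3 (Fin.last n)) 1 +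
      Finsupp.single (vF false (Fin.last n)) 1)) := by
    intro k hk
    simp [conf_add_S, conf_single_S, wS, conf_add_F, conf_single_F, wF, conf_add_C,
        conf_single_C, wC, conf_add_B, conf_single_B, wB, hk.ne']
  have hzv : Zl n (conf n (Finsupp.single vl 1)) := by
    intro k hk
    simp [conf_add_S, conf_single_S, wS, conf_add_F, conf_single_F, wF, conf_add_C,
        conf_single_C, wC, conf_add_B, conf_single_B, wB]
  have hF : 1 ≤ (conf n (Finsupp.single (vC false 3 (Fin.last n)) 1 +
      Finsupp.single (vF false (Fin.last n)) 1 + w)).F n := by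
    simp [conf_add_F, conf_single_F, wF]
  rw [Sab_tok ⟨n, le_rfl, Or.inr hF⟩]
  simp only [Rl_F hF]
  unfold Sab
  rw [Zl_add hzu, Zl_add hzv]
  generalize Zl n (conf n w) = Z
  simp [conf_add_S, conf_single_S, wS, conf_add_F, conf_single_F, wF, conf_add_C,
        conf_single_C, wC, conf_add_B, conf_single_B, wB, Finsupp.single_apply,
        Fin.forall_fin_succ (n := 3), Fin.forall_fin_succ (n := 2), Fin.forall_fin_succ (n := 1)]
  refine fun _ _ _ _ _ => ?_
  constructor
  · rintro ⟨⟨h6, h7, hz⟩, h8, h9, h10, h11, h12, h13, h14, h15⟩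
    exact ⟨hz, h6, h7, ⟨h8, h9, h10, h11⟩, h12, h13, h14, by omega⟩
  · rintro ⟨hz, h6, h7, ⟨h8, h9, h10, h11⟩, h12, h13, h14, h15⟩
    exact ⟨⟨h6, h7, hz⟩, h8, h9, h10, h11, h12, h13, h14, by omega⟩

end GGclosed

/-- The linear functional summing the coefficients of the monomials satisfying `Q`. -/
noncomputable def Lam {n : ℕ} (Q : Mon (MVar n) → Prop) : MPoly n →ₗ[ZMod 2] ZMod 2 :=
  open Classical in
  (MvPolynomial.basisMonomials (MVar n) (ZMod 2)).constr (ZMod 2) fun t => if Q t then 1 else 0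

lemma Lam_monomial {n : ℕ} (Q : Mon (MVar n) → Prop) (t : Mon (MVar n)) :
    Lam Q (monomial t 1) = open Classical in if Q t then 1 else 0 := by
  have := (MvPolynomial.basisMonomials (MVar n) (ZMod 2)).constr_basis (ZMod 2)
    (fun t => open Classical in if Q t then (1 : ZMod 2) else 0) t
  simpa [Lam, MvPolynomial.coe_basisMonomials] using this

lemma Lam_binom {n : ℕ} {Q : Mon (MVar n) → Prop} {u v : Mon (MVar n)} (h : Clo Q u v)
    (q : MPoly n) : Lam Q (q * (monomial u 1 + monomial v 1)) = 0 := by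
  induction q using MvPolynomial.induction_on' with
  | monomial w c =>
    have h2 : (monomial w c : MPoly n) = c • monomial w 1 := by simp [smul_monomial]
    rw [h2, smul_mul_assoc, map_smul, mul_add, monomial_mul, monomial_mul, map_add]
    rw [mul_one, Lam_monomial, Lam_monomial, add_comm w, add_comm w]
    have h3 := h w
    by_cases hq : Q (u + w)
    · rw [if_pos hq, if_pos (h3.1 hq), CharTwo.add_self_eq_zero, smul_zero]
    · rw [if_neg hq, if_neg (fun h' => hq (h3.2 h')), add_zero, smul_zero]
  | add p q hp hq => rw [add_mul, map_add, hp, hq, add_zero]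

lemma Lam_ideal {n : ℕ} {Q : Mon (MVar n) → Prop} {F : Set (MPoly n)}
    (h : ∀ p ∈ F, ∀ q, Lam Q (q * p) = 0) {p : MPoly n} (hp : p ∈ Ideal.span F) :
    Lam Q p = 0 := by
  suffices ∀ q, Lam Q (q * p) = 0 by simpa using this 1
  induction hp using Submodule.span_induction with
  | mem x hx => exact h x hx
  | zero => simp
  | add x y _ _ hx hy => intro q; rw [mul_add, map_add, hx, hy, add_zero]
  | smul r x _ hx => intro q; rw [smul_eq_mul, ← mul_assoc]; exact hx _

lemma Lam_HT {n : ℕ} {Q : Mon (MVar n) → Prop} {p : MPoly n} {u : Mon (MVar n)}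
    (hu : IsHT (lexLe n) p u) (hQu : Q u) (hQ : ∀ t, Q t → lexLe n t u → t = u) :
    Lam Q p ≠ 0 := by
  have h1 : Lam Q p = ∑ t ∈ p.support, open Classical in if Q t then 1 else 0 := by
    conv_lhs => rw [p.as_sum]
    rw [map_sum]
    refine Finset.sum_congr rfl fun t ht => ?_
    have : coeff t p = 1 := by
      have h0 := mem_support_iff.1 ht
      revert h0
      generalize coeff t p = c
      revert c
      decide
    rw [this, Lam_monomial]
  rw [h1, Finset.sum_eq_single u]
  · simp [hQu]
  · intro t ht htu
    rw [if_neg]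
    intro hq
    exact htu (hQ t hq (hu.2 t ht))
  · intro h
    exact absurd hu.1 h

section FFclosed
variable {n : ℕ}

lemma Lam_FF_Sab {a b : ℕ} (hab : a + b < en n) : ∀ p ∈ FF n, ∀ q, Lam (Sab n a b) (q * p) = 0 := by
  have hbar : ∀ u v : Mon (MVar n), (∃ i, u (vS true i) ≠ 0 ∨ u (vF true i) ≠ 0) →
      (∃ i, v (vS true i) ≠ 0 ∨ v (vF true i) ≠ 0) → Clo (Sab n a b) u v := by
    rintro u v ⟨i, hi⟩ ⟨i', hi'⟩ w
    refine iff_of_false (Sab_bar i ?_) (Sab_bar i' ?_)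
    · simp only [Finsupp.add_apply]; omega
    · simp only [Finsupp.add_apply]; omega
  have hPb : ∀ p ∈ PP n true, ∀ q, Lam (Sab n a b) (q * p) = 0 := by
    intro p hp q
    simp only [PP, P0, Pm, Set.mem_union, Set.mem_iUnion, Set.mem_insert_iff,
      Set.mem_singleton_iff, Set.mem_setOf_eq] at hp
    rcases hp with ⟨j, rfl⟩ | ⟨i, (rfl | rfl | rfl | rfl | rfl | rfl) | ⟨j, rfl⟩⟩ <;>
      simp only [X, monomial_mul, monomial_pow, mul_one, one_pow] <;>
      apply Lam_binom <;> apply hbar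
    all_goals first
      | (refine ⟨0, ?_⟩; simp; done)
      | (refine ⟨i.castSucc, ?_⟩; simp; done)
      | (refine ⟨i.succ, ?_⟩; simp; done)
  have hP : ∀ p ∈ PP n false, ∀ q, Lam (Sab n a b) (q * p) = 0 := by
    intro p hp q
    simp only [PP, P0, Pm, Set.mem_union, Set.mem_iUnion, Set.mem_insert_iff,
      Set.mem_singleton_iff, Set.mem_setOf_eq] at hp
    rcases hp with ⟨j, rfl⟩ | ⟨i, (rfl | rfl | rfl | rfl | rfl | rfl) | ⟨j, rfl⟩⟩ <;>
      simp only [X, monomial_mul, monomial_pow, mul_one, one_pow, Finsupp.smul_single,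
        smul_eq_mul] <;> apply Lam_binom
    · exact clo_P0 j
    · exact clo_P1 i
    · exact clo_P2 i
    · exact clo_P3 i
    · exact clo_P4 i
    · exact clo_P5 i
    · exact clo_P6 i
    · exact clo_P7 i j
  intro p hp
  rcases hp with (hp | hp) | hp
  · exact hP p hp
  · exact hPb p hp
  · intro q
    simp only [GG, Set.mem_insert_iff, Set.mem_singleton_iff] at hp
    rcases hp with rfl | rfl | rfl | rfl | rfl | rfl | rfl <;>
      simp only [X, monomial_mul, mul_one] <;> apply Lam_binom
    · exact clo_G1
    · exact clo_G2
    · exact clo_G3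
    · intro w
      refine iff_of_false (Sab_bar (Fin.last n) ?_) (not_Sab_S hab ?_)
      · right; simp
      · simp
    · intro w
      refine iff_of_false (not_Sab_S hab ?_) (not_Sab_S hab ?_) <;> simp
    · intro w
      refine iff_of_false (not_Sab_S hab ?_) (not_Sab_S hab ?_) <;> simp
    · intro w
      refine iff_of_false (Sab_bar (Fin.last n) ?_) ?_
      · left; simp
      · rintro ⟨h, -⟩
        simp at h

/-- Token variables. -/
def isTok : MVar n → Prop
  | vs => True
  | vl => True
  | vS _ _ => True
  | vF _ _ => True
  | _ => False

lemma Lam_FF_single {u : Mon (MVar n)} (hu : ∀ x, isTok x → u x = 0) :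
    ∀ p ∈ FF n, ∀ q, Lam (fun t => t = u) (q * p) = 0 := by
  have htok : ∀ u1 v1 : Mon (MVar n), (∃ x, isTok x ∧ u1 x ≠ 0) →
      (∃ x, isTok x ∧ v1 x ≠ 0) → Clo (fun t => t = u) u1 v1 := by
    rintro u1 v1 ⟨x, hx, hx'⟩ ⟨y, hy, hy'⟩ w
    refine iff_of_false ?_ ?_
    · rintro rfl
      have := hu x hx
      simp only [Finsupp.add_apply] at this
      omega
    · rintro rfl
      have := hu y hy
      simp only [Finsupp.add_apply] at this
      omega
  have hP : ∀ c, ∀ p ∈ PP n c, ∀ q, Lam (fun t => t = u) (q * p) = 0 := by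
    intro c p hp q
    simp only [PP, P0, Pm, Set.mem_union, Set.mem_iUnion, Set.mem_insert_iff,
      Set.mem_singleton_iff, Set.mem_setOf_eq] at hp
    rcases hp with ⟨j, rfl⟩ | ⟨i, (rfl | rfl | rfl | rfl | rfl | rfl) | ⟨j, rfl⟩⟩ <;>
      simp only [X, monomial_mul, monomial_pow, mul_one, one_pow] <;>
      apply Lam_binom <;> apply htok
    all_goals first
      | (refine ⟨vS c 0, trivial, ?_⟩; simp; done)
      | (refine ⟨vF c 0, trivial, ?_⟩; simp; done)
      | (refine ⟨vS c i.castSucc, trivial, ?_⟩; simp; done)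
      | (refine ⟨vF c i.castSucc, trivial, ?_⟩; simp; done)
      | (refine ⟨vS c i.succ, trivial, ?_⟩; simp; done)
      | (refine ⟨vF c i.succ, trivial, ?_⟩; simp; done)
  intro p hp
  rcases hp with (hp | hp) | hp
  · exact hP _ p hp
  · exact hP _ p hp
  · intro q
    simp only [GG, Set.mem_insert_iff, Set.mem_singleton_iff] at hp
    rcases hp with rfl | rfl | rfl | rfl | rfl | rfl | rfl <;>
      simp only [X, monomial_mul, mul_one] <;> apply Lam_binom <;> apply htok
    all_goals first
      | (refine ⟨vs, trivial, ?_⟩; simp; done)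
      | (refine ⟨vl, trivial, ?_⟩; simp; done)
      | (refine ⟨vS false (Fin.last n), trivial, ?_⟩; simp; done)
      | (refine ⟨vF false (Fin.last n), trivial, ?_⟩; simp; done)
      | (refine ⟨vS true (Fin.last n), trivial, ?_⟩; simp; done)
      | (refine ⟨vF true (Fin.last n), trivial, ?_⟩; simp; done)

end FFclosed

/-! ### Positive part: the monomials `ℓ c̄^m₁ c^m₂`, `m₁ + m₂ = e(n)`, are equivalent to `s` -/

/-- One level of the machine in a commutative ring. -/
lemma machine_step {A : Type*} [CommRing A] (E : ℕ) (hE : 0 < E)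
    (s f q1 q2 q3 q4 c1 c2 c3 c4 b1 b2 b3 b4 s' f' K y : A)
    (h1 : c1 * s = b1 ^ E * c1 * f) (h2 : c2 * s = b2 ^ E * c2 * f)
    (h3 : c3 * s = b3 ^ E * c3 * f) (h4 : c4 * s = b4 ^ E * c4 * f)
    (r1 : q1 * c1 * s = s') (r2 : q2 * c2 * s = q1 * b1 * c1 * f)
    (r3 : q3 * c3 * f = q2 * c2 * f) (r4 : q3 * b1 * c3 * s = q2 * b4 * c2 * s)
    (r5 : q4 * b4 * c4 * f = q3 * c3 * s) (r6 : q4 * c4 * s = f')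
    (r7 : q2 * b3 * y * K * f = q2 * b2 * K * f) :
    K * s' = y ^ (E * E) * K * f' := by
  have hb : ∀ k, b2 ^ k * (q2 * K * f) = y ^ k * b3 ^ k * (q2 * K * f) := by
    intro k
    induction k with
    | zero => simp
    | succ k ih =>
      calc b2 ^ (k+1) * (q2 * K * f) = b2 * (b2 ^ k * (q2 * K * f)) := by ring
        _ = y ^ k * b3 ^ k * (q2 * b2 * K * f) := by rw [ih]; ring
        _ = _ := by rw [← r7]; ring
  have loop : K * (q2 * c2 * s) = y ^ E * K * (q3 * c3 * s) := by
    calc K * (q2 * c2 * s) = K * q2 * (c2 * s) := by ring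
      _ = c2 * (b2 ^ E * (q2 * K * f)) := by rw [h2]; ring
      _ = y ^ E * b3 ^ E * K * (q2 * c2 * f) := by rw [hb]; ring
      _ = y ^ E * K * q3 * (b3 ^ E * c3 * f) := by rw [← r3]; ring
      _ = _ := by rw [← h3]; ring
  have it : ∀ k, b1 ^ k * (K * (q2 * c2 * s)) = y ^ (E * k) * b4 ^ k * (K * (q2 * c2 * s)) := by
    intro k
    induction k with
    | zero => simp
    | succ k ih =>
      calc b1 ^ (k+1) * (K * (q2 * c2 * s)) = b1 * (b1 ^ k * (K * (q2 * c2 * s))) := by ring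
        _ = b1 * y ^ (E * k) * b4 ^ k * (y ^ E * K * (q3 * c3 * s)) := by rw [ih, loop]; ring
        _ = y ^ (E * k) * b4 ^ k * y ^ E * K * (q3 * b1 * c3 * s) := by ring
        _ = _ := by rw [r4]; ring
  obtain ⟨e, rfl⟩ : ∃ e, E = e + 1 := ⟨E - 1, by omega⟩
  calc K * s' = K * q1 * (c1 * s) := by rw [← r1]; ring
    _ = K * b1 ^ e * (q1 * b1 * c1 * f) := by rw [h1]; ring
    _ = b1 ^ e * (K * (q2 * c2 * s)) := by rw [← r2]; ring
    _ = y ^ ((e+1) * e) * b4 ^ e * (y ^ (e+1) * K * (q3 * c3 * s)) := by rw [it, loop]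
    _ = y ^ ((e+1) * (e+1)) * K * q4 * (b4 ^ (e+1) * c4 * f) := by rw [← r5]; ring
    _ = y ^ ((e+1) * (e+1)) * K * (q4 * c4 * s) := by rw [← h4]; ring
    _ = _ := by rw [r6]

section positive
variable {n : ℕ}

/-- The quotient map. -/
noncomputable abbrev qm (n : ℕ) : MPoly n →+* MPoly n ⧸ Ideal.span (FF n) :=
  Ideal.Quotient.mk (Ideal.span (FF n))

lemma qm_eq {p q : MPoly n} (h : p + q ∈ FF n) : qm n p = qm n q := by
  rw [Ideal.Quotient.mk_eq_mk_iff_sub_mem, CharTwo.sub_eq_add]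
  exact Ideal.subset_span h

lemma counter (bar : Bool) (m : ℕ) (hm : m < n + 1) (j : Fin 4) :
    qm n (X (vC bar j ⟨m, hm⟩) * X (vS bar ⟨m, hm⟩)) =
      qm n (X (vB bar j ⟨m, hm⟩) ^ en m * X (vC bar j ⟨m, hm⟩) * X (vF bar ⟨m, hm⟩)) := by
  have hPP : ∀ p ∈ PP n bar, p ∈ FF n := by
    intro p hp
    cases bar
    · exact Or.inl (Or.inl hp)
    · exact Or.inl (Or.inr hp)
  induction m generalizing j with
  | zero =>
    symm
    refine qm_eq (hPP _ (Or.inl ⟨j, ?_⟩))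
    simp [en_zero]
  | succ m ih =>
    have hmn : m < n := by omega
    have ih := ih (by omega)
    let i : Fin n := ⟨m, hmn⟩
    have hP : ∀ p ∈ Pm n bar i, p ∈ FF n := fun p hp =>
      hPP p (Or.inr (Set.mem_iUnion.2 ⟨i, hp⟩))
    have hsucc : (⟨m + 1, hm⟩ : Fin (n+1)) = i.succ := rfl
    have hcast : (⟨m, by omega⟩ : Fin (n+1)) = i.castSucc := rfl
    rw [hsucc]
    simp only [hcast] at ih
    have h1 := ih 0
    have h2 := ih 1
    have h3 := ih 2
    have h4 := ih 3
    have r1 := qm_eq (hP _ (Or.inl (Or.inl rfl)))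
    have r2 := qm_eq (hP _ (Or.inl (Or.inr (Or.inl rfl))))
    have r3 := qm_eq (hP _ (Or.inl (Or.inr (Or.inr (Or.inl rfl)))))
    have r4 := qm_eq (hP _ (Or.inl (Or.inr (Or.inr (Or.inr (Or.inl rfl))))))
    have r5 := qm_eq (hP _ (Or.inl (Or.inr (Or.inr (Or.inr (Or.inr (Or.inl rfl)))))))
    have r6 := qm_eq (hP _ (Or.inl (Or.inr (Or.inr (Or.inr (Or.inr (Or.inr rfl)))))))
    have r7 := qm_eq (hP _ (Or.inr ⟨j, rfl⟩))
    simp only [map_mul, map_pow] at *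
    rw [en_succ]
    exact machine_step (en m) (en_pos m) _ _ _ _ _ _ _ _ _ _ _ _ _ _ _ _ _ _ h1 h2 h3 h4
      r1 r2 r3 r4 r5 r6 r7

lemma pow_swap {A : Type*} [CommRing A] {x y z : A} (h : x * y = x * z) (k : ℕ) :
    x * y ^ k = x * z ^ k := by
  induction k with
  | zero => simp
  | succ k ih =>
    calc x * y ^ (k+1) = x * y ^ k * y := by ring
      _ = x * y * z ^ k := by rw [ih]; ring
      _ = _ := by rw [h]; ring

lemma final_calc {A : Type*} [CommRing A] (m1 m2 : ℕ)
    (l b c bb cb b4 c4 s f b4' c4' s' f' s0 : A)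
    (g1 : b4 * l * b = l * c) (g2 : b4 * l * bb = l * cb) (g3 : c4 * f = l)
    (g4 : c4' * f' = c4 * s) (g5 : b4' * c4 * s = c4 * s * b) (g6 : b4' * c4 * s = c4 * s * bb)
    (g7 : c4' * s' = s0) (h : c4 * s = b4 ^ (m1 + m2) * c4 * f)
    (h' : c4' * s' = b4' ^ (m1 + m2) * c4' * f') :
    l * cb ^ m1 * c ^ m2 = s0 := by
  have e1 : l * c ^ m2 = l * (b4 * b) ^ m2 := pow_swap (by rw [← g1]; ring) _
  have e2 : l * cb ^ m1 = l * (b4 * bb) ^ m1 := pow_swap (by rw [← g2]; ring) _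
  have e3 : (c4 * s) * b ^ m2 = (c4 * s) * b4' ^ m2 := pow_swap (by rw [← g5]; ring) _
  have e4 : (c4 * s) * bb ^ m1 = (c4 * s) * b4' ^ m1 := pow_swap (by rw [← g6]; ring) _
  calc l * cb ^ m1 * c ^ m2 = (l * c ^ m2) * (b4 * bb) ^ m1 := by rw [e2]; ring
    _ = (b4 ^ (m1 + m2) * l) * b ^ m2 * bb ^ m1 := by rw [e1]; ring
    _ = (c4 * s * b ^ m2) * bb ^ m1 := by rw [h, ← g3]; ring
    _ = (c4 * s * bb ^ m1) * b4' ^ m2 := by rw [e3]; ring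
    _ = b4' ^ (m1 + m2) * (c4 * s) := by rw [e4]; ring
    _ = s0 := by rw [← g4, ← g7, h']; ring

/-- The head monomials. -/
noncomputable def tmon (n : ℕ) (m1 m2 : ℕ) : Mon (MVar n) :=
  Finsupp.single vl 1 + Finsupp.single vcb m1 + Finsupp.single vc m2

lemma tmon_mem {m1 m2 : ℕ} (hm : m1 + m2 = en n) :
    (monomial (tmon n m1 m2) 1 + monomial (Finsupp.single vs 1) 1 : MPoly n) ∈
      Ideal.span (FF n) := by
  have hG : ∀ p ∈ GG n, p ∈ FF n := fun p hp => Or.inr hp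
  have g1 := qm_eq (hG _ (Or.inl rfl))
  have g2 := qm_eq (hG _ (Or.inr (Or.inl rfl)))
  have g3 := qm_eq (hG _ (Or.inr (Or.inr (Or.inl rfl))))
  have g4 := qm_eq (hG _ (Or.inr (Or.inr (Or.inr (Or.inl rfl)))))
  have g5 := qm_eq (hG _ (Or.inr (Or.inr (Or.inr (Or.inr (Or.inl rfl))))))
  have g6 := qm_eq (hG _ (Or.inr (Or.inr (Or.inr (Or.inr (Or.inr (Or.inl rfl)))))))
  have g7 := qm_eq (hG _ (Or.inr (Or.inr (Or.inr (Or.inr (Or.inr (Or.inr rfl)))))))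
  have h := counter (n := n) false n (by omega) 3
  have h' := counter (n := n) true n (by omega) 3
  rw [← hm] at h h'
  simp only [map_mul, map_pow] at *
  have := final_calc m1 m2 _ _ _ _ _ _ _ _ _ _ _ _ _ _ g1 g2 g3 g4 g5 g6 g7 h h'
  rw [← map_pow, ← map_pow, ← map_mul, ← map_mul, Ideal.Quotient.mk_eq_mk_iff_sub_mem,
    CharTwo.sub_eq_add] at this
  convert this using 2
  simp only [X, monomial_pow, monomial_mul, tmon, Finsupp.smul_single, smul_eq_mul, mul_one,
    one_pow]
  rfl

end positive

section final
variable {n : ℕ}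

lemma vrank_inj_small {x : MVar n} (h : vrank n x ≤ 3) :
    x = vs ∨ x = vc ∨ x = vcb ∨ x = vl := by
  rcases x with _|_|_|_|_|_|⟨_, i⟩|⟨_, i⟩|⟨_, _, i⟩|⟨_, _, i⟩|⟨_, _, i⟩ <;>
    simp [vrank] at h ⊢ <;> omega

lemma lexLe_antisymm {t u : Mon (MVar n)} (hinj : Function.Injective (vrank n))
    (h1 : lexLe n t u) (h2 : lexLe n u t) : t = u := by
  rcases h1 with h1 | ⟨x, hx, hx'⟩
  · exact h1
  rcases h2 with h2 | ⟨y, hy, hy'⟩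
  · exact h2.symm
  rcases lt_trichotomy (vrank n x) (vrank n y) with h | h | h
  · have := hx' y h; omega
  · have := hinj h; subst this; omega
  · have := hy' x h; omega

lemma tmon_apply (m1 m2 : ℕ) (x : MVar n) : tmon n m1 m2 x =
    if x = vl then 1 else if x = vcb then m1 else if x = vc then m2 else 0 := by
  cases x <;> simp [tmon, Finsupp.single_apply]

lemma Sab_self {a b : ℕ} : Sab n a b (tmon n b a) := by
  refine ⟨by simp [tmon_apply], by simp [tmon_apply], by simp [tmon_apply], by simp [tmon_apply],
    Or.inl ⟨by simp [tmon_apply], ?_, ?_⟩⟩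
  · intro k hk
    simp [conf, tmon_apply]
  · simp [conf, tmon_apply]

lemma Sab_min {a b : ℕ} (t : Mon (MVar n)) (ht : Sab n a b t) (h : lexLe n t (tmon n b a)) :
    t = tmon n b a := by
  rcases h with h | ⟨x, hx, hx'⟩
  · exact h
  exfalso
  have hx3 : x = vl ∨ x = vcb ∨ x = vc := by
    by_contra hcon
    push Not at hcon
    rw [tmon_apply] at hx
    simp [hcon] at hx
  have hr : vrank n x ≤ 3 := by rcases hx3 with rfl | rfl | rfl <;> simp [vrank]
  have hb : t vb = 0 := by
    rw [hx' vb (lt_of_le_of_lt hr (by simp [vrank]; try omega))]; simp [tmon_apply]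
  have hbb : t vbb = 0 := by
    rw [hx' vbb (lt_of_le_of_lt hr (by simp [vrank]; try omega))]; simp [tmon_apply]
  have hc : t (vC false 3 (Fin.last n)) = 0 := by
    rw [hx' _ (lt_of_le_of_lt hr (by simp [vrank]; try omega))]; simp [tmon_apply]
  obtain ⟨h1, h2, h3, h4, h5⟩ := ht
  rcases h5 with ⟨h5, -⟩ | ⟨h5, N, -, -, -, -, hC, -⟩
  · rcases hx3 with rfl | rfl | rfl <;> simp [tmon_apply] at hx <;> omega
  · have : (conf n t).C 3 n = t (vC false 3 (Fin.last n)) := by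
      simp [conf, Fin.last]
    omega

/-- No proper divisor of `tmon` is a head monomial of the ideal. -/
lemma HT_dvd {m1 m2 : ℕ} (hm : m1 + m2 = en n) {p : MPoly n} (hp : p ∈ Ideal.span (FF n))
    {u : Mon (MVar n)} (hu : IsHT (lexLe n) p u) (hut : u ≤ tmon n m1 m2) :
    u = tmon n m1 m2 := by
  have hle : ∀ x, u x ≤ tmon n m1 m2 x := hut
  have hul : u vl ≤ 1 := by simpa [tmon_apply] using hle vl
  have hucb : u vcb ≤ m1 := by simpa [tmon_apply] using hle vcb
  have huc : u vc ≤ m2 := by simpa [tmon_apply] using hle vc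
  have hu0 : ∀ x, x ≠ vl → x ≠ vcb → x ≠ vc → u x = 0 := by
    intro x h1 h2 h3
    simpa [tmon_apply, h1, h2, h3] using hle x
  rcases Nat.le_one_iff_eq_zero_or_eq_one.1 hul with h0 | h1
  · exfalso
    refine Lam_HT (Q := fun t => t = u) hu rfl (fun t ht _ => ht)
      (Lam_ideal (Lam_FF_single ?_) hp)
    intro x hx
    by_cases hxl : x = vl
    · rw [hxl, h0]
    · refine hu0 x hxl ?_ ?_ <;> rintro rfl <;> exact hx
  · have hueq : u = tmon n (u vcb) (u vc) := by
      ext x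
      rw [tmon_apply]
      split_ifs with e1 e2 e3
      · rw [e1, h1]
      · rw [e2]
      · rw [e3]
      · exact hu0 x e1 e2 e3
    by_cases hlt : u vc + u vcb < en n
    · exfalso
      rw [hueq] at hu
      exact Lam_HT hu Sab_self Sab_min (Lam_ideal (Lam_FF_Sab hlt) hp)
    · rw [hueq]
      have e1 : u vcb = m1 := by omega
      have e2 : u vc = m2 := by omega
      rw [e1, e2]

lemma tmon_HT {m1 m2 : ℕ} (hm : m1 + m2 = en n) :
    (monomial (tmon n m1 m2) 1 : MPoly n) ∈
      HTset (lexLe n) (↑(Ideal.span (FF n)) : Set (MPoly n)) := by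
  have hne : Finsupp.single vs 1 ≠ tmon n m1 m2 := by
    intro h
    have := DFunLike.congr_fun h vl
    simp [tmon_apply] at this
  have hmem : tmon n m1 m2 ∈
      (monomial (tmon n m1 m2) 1 + monomial (Finsupp.single vs 1) 1 : MPoly n).support := by
    simp [mem_support_iff, coeff_monomial, hne]
  refine ⟨_, tmon_mem hm, ?_, tmon n m1 m2, ⟨hmem, ?_⟩, rfl⟩
  · intro h
    rw [h] at hmem
    simp at hmem
  · intro u hu
    have : u = tmon n m1 m2 ∨ u = Finsupp.single vs 1 := by
      by_contra hcon
      push Not at hcon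
      rw [mem_support_iff] at hu
      simp [coeff_monomial, hcon.1.symm, hcon.2.symm] at hu
    rcases this with rfl | rfl
    · exact Or.inl rfl
    · refine Or.inr ⟨vl, by simp [tmon_apply], fun y hy => ?_⟩
      have hy' : 3 < vrank n y := by simpa [vrank] using hy
      have e1 : y ≠ vs := by rintro rfl; simp [vrank] at hy'
      have e2 : y ≠ vl := by rintro rfl; simp [vrank] at hy'
      have e3 : y ≠ vc := by rintro rfl; simp [vrank] at hy'
      have e4 : y ≠ vcb := by rintro rfl; simp [vrank] at hy'
      simp [tmon_apply, e1, e2, e3, e4]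

lemma exists_GB {G : Finset (MPoly n)} (hG : IsGB (lexLe n) G (Ideal.span (FF n)))
    {m1 m2 : ℕ} (hm : m1 + m2 = en n) : ∃ g ∈ G, IsHT (lexLe n) g (tmon n m1 m2) := by
  obtain ⟨hsub, -, hHT⟩ := hG
  have h1 := Ideal.subset_span (tmon_HT hm)
  rw [hHT] at h1
  have h2 : HTset (lexLe n) (↑G : Set (MPoly n)) =
      (fun s => (monomial s 1 : MPoly n)) '' {t | ∃ f ∈ G, IsHT (lexLe n) f t} := by
    ext p
    constructor
    · rintro ⟨f, hf, -, t, ht, rfl⟩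
      exact ⟨t, ⟨f, hf, ht⟩, rfl⟩
    · rintro ⟨t, ⟨f, hf, ht⟩, rfl⟩
      refine ⟨f, hf, ?_, t, ht, rfl⟩
      rintro rfl
      have := ht.1
      simp at this
  rw [h2, SetLike.mem_coe, mem_ideal_span_monomial_image] at h1
  obtain ⟨u, ⟨g, hg, hgu⟩, hu⟩ := h1 (tmon n m1 m2) (by simp [mem_support_iff])
  exact ⟨g, hg, HT_dvd hm (hsub hg) hgu hu ▸ hgu⟩

lemma HT_tmon_inj {g : MPoly n} {a b a' b' : ℕ} (h : IsHT (lexLe n) g (tmon n a b))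
    (h' : IsHT (lexLe n) g (tmon n a' b')) : a = a' := by
  have h1 := h.2 _ h'.1
  have h2 := h'.2 _ h.1
  rcases h1 with h1 | ⟨x, hx, hx'⟩
  · have := DFunLike.congr_fun h1 vcb
    simpa [tmon_apply] using this.symm
  rcases h2 with h2 | ⟨y, hy, hy'⟩
  · have := DFunLike.congr_fun h2 vcb
    simpa [tmon_apply] using this
  have hx3 : x = vl ∨ x = vcb ∨ x = vc := by
    by_contra hcon
    push Not at hcon
    rw [tmon_apply, tmon_apply] at hx
    simp [hcon] at hx
  have hy3 : y = vl ∨ y = vcb ∨ y = vc := by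
    by_contra hcon
    push Not at hcon
    rw [tmon_apply, tmon_apply] at hy
    simp [hcon] at hy
  have hc1 := hx' vcb
  have hc2 := hy' vcb
  rcases hx3 with rfl | rfl | rfl <;> rcases hy3 with rfl | rfl | rfl <;>
    simp [tmon_apply, vrank] at hx hy hc1 hc2 <;> omega

end final
/-- Every reduced Gröbner basis `G` of `⟨𝓕⟩` with respect to the
lexicographic order `≼_lex` satisfies `|G| ≥ 2^(2^n)` and
`|{p ∈ G : deg p ≥ 2^(2^n)}| ≥ 2^(2^n)`. -/
theorem stmt16 (n : ℕ) (G : Finset (MPoly n))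
    (hG : IsReducedGB (lexLe n) G (Ideal.span (FF n))) :
    en n ≤ G.card ∧ en n ≤ (G.filter fun p => en n ≤ p.totalDegree).card := by
  have hGB := hG.1
  have key : ∀ k : Fin (en n), ∃ g ∈ G, IsHT (lexLe n) g (tmon n k (en n - k)) := fun k =>
    exists_GB hGB (by omega)
  choose g hg hHT using key
  have hinj : Function.Injective g := by
    intro k k' hkk
    have h := hHT k
    rw [hkk] at h
    exact Fin.ext (HT_tmon_inj h (hHT k'))
  have hcard : en n ≤ (G.filter fun p => en n ≤ p.totalDegree).card := by
    have h1 : (Finset.univ.image g).card = en n := by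
      rw [Finset.card_image_of_injective _ hinj]
      simp
    rw [← h1]
    refine Finset.card_le_card ?_
    intro p hp
    obtain ⟨k, -, rfl⟩ := Finset.mem_image.1 hp
    refine Finset.mem_filter.2 ⟨hg k, ?_⟩
    have h2 := le_totalDegree (hHT k).1
    have h3 : ((tmon n k (en n - k)).sum fun _ e => e) = 1 + k + (en n - k) := by
      generalize en n - (k : ℕ) = m
      simp [tmon, Finsupp.sum_add_index']
    rw [h3] at h2
    have := k.2
    omega
  exact ⟨hcard.trans (Finset.card_filter_le _ _), hcard⟩
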